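/- arXiv:1502.05971 — 2 statements merged into one kernel-verified Lean document; each statement's English description precedes it below -/
import Mathlib

section
/- For x > 0 and ν > 0 (ν not a nonpositive integer), ∫_x^∞ J_ν(t) Y_ν(t)/t dt = [ln(x/2) − ψ(ν)]/(νπ) − (1/(2ν)) ∑_{n=0}^∞ { ε_n J_{ν+n}(x) Y_{ν+n}(x) + 2/(π(ν+n)) }, where ε₀ = 1, ε_n = 2 for n ≥ 1, and ψ is the digamma function; the series converges. -/
open MeasureTheory Real Filter Set Topology

noncomputable def besselJ (ν x : ℝ) : ℝ :=
  (x / 2) ^ ν * ∑' k : ℕ, (-1 : ℝ) ^ k * (x ^ 2 / 4) ^ k / (k.factorial * Real.Gamma (ν + k + 1))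

noncomputable def besselY (ν x : ℝ) : ℝ :=
  limUnder (𝓝[{μ : ℝ | ∀ n : ℤ, μ ≠ (n : ℝ)}] ν)
    (fun μ => (besselJ μ x * Real.cos (μ * Real.pi) - besselJ (-μ) x) / Real.sin (μ * Real.pi))

noncomputable def digamma (s : ℝ) : ℝ := deriv (fun t => Real.log (Real.Gamma t)) s

/-- The reciprocal Gamma function is bounded along the shifts of a bounded set. -/
lemma exists_norm_inv_Gamma_le (R : ℝ) :
    ∃ M : ℝ, 0 ≤ M ∧ ∀ z : ℂ, ‖z‖ ≤ R → ∀ k : ℕ, ‖(Complex.Gamma (z + k + 1))⁻¹‖ ≤ M := by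
  have hb : ∀ k : ℕ, ∃ M : ℝ, ∀ z : ℂ, ‖z‖ ≤ R → ‖(Complex.Gamma (z + k + 1))⁻¹‖ ≤ M := by
    intro k
    have hc : Continuous fun z : ℂ => (Complex.Gamma (z + k + 1))⁻¹ :=
      Complex.differentiable_one_div_Gamma.continuous.comp (by fun_prop : Continuous fun z : ℂ => z + k + 1)
    obtain ⟨M, hM⟩ := (isCompact_closedBall (0 : ℂ) R).exists_bound_of_continuousOn hc.continuousOn
    exact ⟨M, fun z hz => hM z (by simpa using hz)⟩
  choose B hB using hb
  set m := ⌈R⌉₊ with hm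
  refine ⟨∑ k ∈ Finset.range (m + 1), |B k|, Finset.sum_nonneg fun _ _ => abs_nonneg _, ?_⟩
  intro z hz k
  have small : ∀ k ≤ m, ‖(Complex.Gamma (z + k + 1))⁻¹‖ ≤ ∑ k ∈ Finset.range (m + 1), |B k| := by
    intro k hk
    refine ((hB k z hz).trans (le_abs_self _)).trans ?_
    exact Finset.single_le_sum (f := fun k => |B k|) (fun _ _ => abs_nonneg _)
      (Finset.mem_range.2 (Nat.lt_succ_of_le hk))
  rcases le_total k m with hk | hk
  · exact small k hk
  · induction k, hk using Nat.le_induction with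
    | base => exact small m le_rfl
    | succ k hk ih =>
      refine le_trans ?_ ih
      rw [Complex.one_div_Gamma_eq_self_mul_one_div_Gamma_add_one (z + k + 1)]
      have h1 : (1 : ℝ) ≤ ‖z + k + 1‖ := by
        have h2 : ‖((k : ℂ) + 1)‖ = k + 1 := by
          have : ((k : ℂ) + 1) = ((k + 1 : ℕ) : ℂ) := by push_cast; ring
          rw [this, Complex.norm_natCast]; push_cast; ring
        have h3 := norm_sub_le (z + k + 1) z
        have h4 : z + k + 1 - z = (k : ℂ) + 1 := by ring
        rw [h4, h2] at h3
        have h5 : R ≤ k := (Nat.le_ceil R).trans (by exact_mod_cast hk)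
        linarith
      rw [norm_mul]
      have : z + ((k + 1 : ℕ) : ℂ) + 1 = z + k + 1 + 1 := by push_cast; ring
      rw [this]
      exact le_mul_of_one_le_left (norm_nonneg _) h1

lemma inv_Gamma_eq_mul (s : ℝ) : (Real.Gamma s)⁻¹ = s * (Real.Gamma (s + 1))⁻¹ := by
  have h := Complex.one_div_Gamma_eq_self_mul_one_div_Gamma_add_one (s : ℂ)
  rw [show (s : ℂ) + 1 = ((s + 1 : ℝ) : ℂ) by push_cast; ring, Complex.Gamma_ofReal,
    Complex.Gamma_ofReal] at h
  exact_mod_cast h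

lemma exists_abs_inv_Gamma_le (R : ℝ) :
    ∃ M : ℝ, 0 ≤ M ∧ ∀ ν : ℝ, |ν| ≤ R → ∀ k : ℕ, |(Real.Gamma (ν + k + 1))⁻¹| ≤ M := by
  obtain ⟨M, hM, h⟩ := exists_norm_inv_Gamma_le R
  refine ⟨M, hM, fun ν hν k => ?_⟩
  have := h ν (by simpa using hν) k
  rw [show (ν : ℂ) + k + 1 = ((ν + k + 1 : ℝ) : ℂ) by push_cast; ring, Complex.Gamma_ofReal,
    ← Complex.ofReal_inv, Complex.norm_real] at this
  exact this

/-- Exponential generating series with bounded coefficients are summable. -/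
lemma summable_expSeries {a : ℕ → ℝ} {M : ℝ} (ha : ∀ k, |a k| ≤ M) (y : ℝ) :
    Summable fun k => a k * y ^ k / k.factorial := by
  refine Summable.of_norm_bounded ((Real.summable_pow_div_factorial |y|).mul_left M) fun k => ?_
  rw [norm_div, norm_mul, norm_pow, Real.norm_eq_abs, Real.norm_eq_abs, Real.norm_natCast,
    mul_div_assoc]
  exact mul_le_mul_of_nonneg_right (ha k) (by positivity)

lemma hasDerivAt_expSeries {a : ℕ → ℝ} {M : ℝ} (ha : ∀ k, |a k| ≤ M) (y : ℝ) :
    HasDerivAt (fun y : ℝ => ∑' k, a k * y ^ k / k.factorial)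
      (∑' k, a (k + 1) * y ^ k / k.factorial) y := by
  set B := |y| + 1 with hB
  have hB0 : 0 ≤ B := by positivity
  have hM : 0 ≤ M := (abs_nonneg _).trans (ha 0)
  have hs : Summable fun k : ℕ => M * (k * B ^ (k - 1) / k.factorial) := by
    refine Summable.mul_left _ ((summable_nat_add_iff 1).1 ?_)
    refine (Real.summable_pow_div_factorial B).congr fun k => ?_
    rw [Nat.factorial_succ, Nat.add_sub_cancel]; push_cast
    field_simp
  have key := hasDerivAt_tsum_of_isPreconnected (𝕜 := ℝ) (t := Metric.ball (0 : ℝ) B)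
    (g := fun k y => a k * y ^ k / k.factorial)
    (g' := fun k y => a k * (k * y ^ (k - 1)) / k.factorial) (y₀ := 0) (y := y) hs
    Metric.isOpen_ball (convex_ball _ _).isPreconnected
    (fun n z _ => ((hasDerivAt_pow n z).const_mul (a n)).div_const _)
    (fun n z hz => by
      have hz' : |z| ≤ B := by simpa using (le_of_lt (mem_ball_zero_iff.1 hz))
      rw [norm_div, norm_mul, norm_mul, norm_pow, Real.norm_eq_abs, Real.norm_natCast,
        Real.norm_natCast, mul_div_assoc, Real.norm_eq_abs]
      gcongr
      exact ha n)
    (Metric.mem_ball_self (by positivity)) (summable_expSeries ha 0)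
    (mem_ball_zero_iff.2 (by rw [Real.norm_eq_abs]; linarith))
  refine key.congr_deriv ?_
  have hsum : Summable fun k : ℕ => a k * (k * y ^ (k - 1)) / k.factorial := by
    refine Summable.of_norm_bounded hs fun n => ?_
    rw [norm_div, norm_mul, norm_mul, norm_pow, Real.norm_eq_abs, Real.norm_natCast,
        Real.norm_natCast, mul_div_assoc, Real.norm_eq_abs]
    gcongr
    · exact ha n
    · linarith
  rw [hsum.tsum_eq_zero_add]
  simp only [Nat.cast_zero, zero_mul, mul_zero, zero_div, zero_add]
  refine tsum_congr fun k => ?_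
  rw [Nat.factorial_succ, Nat.add_sub_cancel]; push_cast
  field_simp

/-- The entire part `∑ (-y)^k / (k! Γ(ν+k+1))` of the Bessel function of the first kind. -/
noncomputable def besselSeries (ν y : ℝ) : ℝ :=
  ∑' k : ℕ, (-1 : ℝ) ^ k * (Real.Gamma (ν + k + 1))⁻¹ * y ^ k / k.factorial

lemma besselJ_eq (ν x : ℝ) : besselJ ν x = (x / 2) ^ ν * besselSeries ν (x ^ 2 / 4) := by
  unfold besselJ besselSeries
  congr 1
  refine tsum_congr fun k => ?_
  rw [div_eq_mul_inv, div_eq_mul_inv, mul_inv]; ring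

lemma abs_besselCoeff_le {ν M : ℝ} (h : ∀ k : ℕ, |(Real.Gamma (ν + k + 1))⁻¹| ≤ M) (k : ℕ) :
    |(-1 : ℝ) ^ k * (Real.Gamma (ν + k + 1))⁻¹| ≤ M := by
  rw [abs_mul, abs_pow, abs_neg, abs_one, one_pow, one_mul]; exact h k

lemma summable_besselSeries (ν y : ℝ) :
    Summable fun k : ℕ => (-1 : ℝ) ^ k * (Real.Gamma (ν + k + 1))⁻¹ * y ^ k / k.factorial := by
  obtain ⟨M, -, h⟩ := exists_abs_inv_Gamma_le |ν|
  exact summable_expSeries (abs_besselCoeff_le (h ν le_rfl)) y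

lemma abs_besselSeries_le {ν M : ℝ} (h : ∀ k : ℕ, |(Real.Gamma (ν + k + 1))⁻¹| ≤ M) {y : ℝ}
    (hy : 0 ≤ y) : |besselSeries ν y| ≤ M * Real.exp y := by
  have h2 : HasSum (fun k : ℕ => M * (y ^ k / k.factorial)) (M * Real.exp y) := by
    have := NormedSpace.expSeries_div_hasSum_exp (𝔸 := ℝ) y
    rw [← Real.exp_eq_exp_ℝ] at this
    exact this.mul_left M
  rw [← Real.norm_eq_abs, besselSeries]
  refine tsum_of_norm_bounded h2 fun k => ?_
  rw [norm_div, norm_mul, norm_pow, Real.norm_natCast, Real.norm_of_nonneg hy, mul_div_assoc]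
  exact mul_le_mul_of_nonneg_right (abs_besselCoeff_le h k) (by positivity)

lemma hasDerivAt_besselSeries (ν y : ℝ) :
    HasDerivAt (besselSeries ν) (-besselSeries (ν + 1) y) y := by
  obtain ⟨M, -, h⟩ := exists_abs_inv_Gamma_le |ν|
  have := hasDerivAt_expSeries (abs_besselCoeff_le (h ν le_rfl)) y
  refine this.congr_deriv ?_
  unfold besselSeries
  rw [← tsum_neg]
  refine tsum_congr fun k => ?_
  push_cast
  rw [show ν + 1 + (k : ℝ) + 1 = ν + (k + 1) + 1 by ring]
  ring

lemma besselSeries_recurrence (ν y : ℝ) :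
    besselSeries (ν - 1) y = ν * besselSeries ν y - y * besselSeries (ν + 1) y := by
  have h1 := (summable_besselSeries ν y).mul_left ν
  have h2 := (summable_besselSeries (ν + 1) y).mul_left (-y)
  set f : ℕ → ℝ := fun k => k * ((-1 : ℝ) ^ k * (Real.Gamma (ν + k + 1))⁻¹ * y ^ k / k.factorial)
    with hf
  have hshift : ∀ k, f (k + 1) = -y *
      ((-1 : ℝ) ^ k * (Real.Gamma (ν + 1 + k + 1))⁻¹ * y ^ k / k.factorial) := by
    intro k
    simp only [hf]
    rw [Nat.factorial_succ]; push_cast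
    rw [show ν + 1 + (k : ℝ) + 1 = ν + (k + 1) + 1 by ring]
    field_simp
    ring
  have h3 : Summable f := (summable_nat_add_iff 1).1 (h2.congr fun k => (hshift k).symm)
  have h4 : ∑' k, f k = -y * besselSeries (ν + 1) y := by
    rw [h3.tsum_eq_zero_add]
    simp only [hshift]
    rw [tsum_mul_left]
    simp [hf, besselSeries]
  have h5 : besselSeries (ν - 1) y = ∑' k : ℕ,
      (ν * ((-1 : ℝ) ^ k * (Real.Gamma (ν + k + 1))⁻¹ * y ^ k / k.factorial) + f k) := by
    unfold besselSeries
    refine tsum_congr fun k => ?_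
    rw [show ν - 1 + (k : ℝ) + 1 = ν + k by ring, inv_Gamma_eq_mul (ν + k)]
    simp only [hf]; ring
  rw [h5, h1.tsum_add h3, tsum_mul_left, h4]
  simp only [besselSeries]; ring

lemma besselJ_recurrence (ν : ℝ) {x : ℝ} (hx : 0 < x) :
    besselJ (ν - 1) x + besselJ (ν + 1) x = 2 * ν / x * besselJ ν x := by
  have h2 : (0 : ℝ) < x / 2 := by positivity
  rw [besselJ_eq, besselJ_eq, besselJ_eq, besselSeries_recurrence, Real.rpow_sub_one h2.ne',
    Real.rpow_add_one h2.ne']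
  field_simp
  ring

lemma hasDerivAt_besselJ (ν : ℝ) {x : ℝ} (hx : 0 < x) :
    HasDerivAt (besselJ ν) (ν / x * besselJ ν x - besselJ (ν + 1) x) x := by
  have h2 : (0 : ℝ) < x / 2 := by positivity
  have e : besselJ ν = fun x => (x / 2) ^ ν * besselSeries ν (x ^ 2 / 4) := funext (besselJ_eq ν)
  rw [besselJ_eq (ν + 1), besselJ_eq ν x, e, Real.rpow_add_one h2.ne']
  have d1 : HasDerivAt (fun x : ℝ => (x / 2) ^ ν) (1 / 2 * ν * (x / 2) ^ (ν - 1)) x :=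
    ((hasDerivAt_id x).div_const 2).rpow_const (Or.inl h2.ne')
  have d2 : HasDerivAt (fun x : ℝ => x ^ 2 / 4) (2 * x / 4) x := by
    simpa using (hasDerivAt_pow 2 x).div_const 4
  have d3 := (hasDerivAt_besselSeries ν (x ^ 2 / 4)).comp x d2
  refine (d1.mul d3).congr_deriv ?_
  rw [Real.rpow_sub_one h2.ne']
  simp only [Function.comp]
  field_simp
  ring

lemma hasDerivAt_besselJ' (ν : ℝ) {x : ℝ} (hx : 0 < x) :
    HasDerivAt (besselJ ν) (besselJ (ν - 1) x - ν / x * besselJ ν x) x := by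
  refine (hasDerivAt_besselJ ν hx).congr_deriv ?_
  have := besselJ_recurrence ν hx
  linear_combination -this

/-- A pair of functions satisfying the differential-difference relations of two Bessel functions
of consecutive orders `ν` and `ν + 1`. -/
structure IsBesselPair (ν : ℝ) (u v : ℝ → ℝ) : Prop where
  fst : ∀ t, 0 < t → HasDerivAt u (ν / t * u t - v t) t
  snd : ∀ t, 0 < t → HasDerivAt v (u t - (ν + 1) / t * v t) t

lemma isBesselPair_besselJ (ν : ℝ) : IsBesselPair ν (besselJ ν) (besselJ (ν + 1)) where
  fst t ht := hasDerivAt_besselJ ν ht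
  snd t ht := by simpa using hasDerivAt_besselJ' (ν + 1) ht

lemma isBesselPair_besselJ_neg (ν : ℝ) :
    IsBesselPair ν (besselJ (-ν)) (fun t => -besselJ (-(ν + 1)) t) where
  fst t ht := by
    refine (hasDerivAt_besselJ' (-ν) ht).congr_deriv ?_
    rw [show -(ν + 1) = -ν - 1 by ring]; ring
  snd t ht := by
    have := (hasDerivAt_besselJ (-(ν + 1)) ht).neg
    rw [show -(ν + 1) + 1 = -ν by ring] at this
    refine this.congr_deriv ?_
    ring

lemma IsBesselPair.linear_comb {ν : ℝ} {u v u' v' : ℝ → ℝ} (h : IsBesselPair ν u v)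
    (h' : IsBesselPair ν u' v') (a b : ℝ) :
    IsBesselPair ν (fun t => a * u t + b * u' t) (fun t => a * v t + b * v' t) where
  fst t ht := by
    refine (((h.fst t ht).const_mul a).add ((h'.fst t ht).const_mul b)).congr_deriv ?_
    ring
  snd t ht := by
    refine (((h.snd t ht).const_mul a).add ((h'.snd t ht).const_mul b)).congr_deriv ?_
    ring

lemma le_of_forall_hasDerivAt_nonpos {f f' : ℝ → ℝ} {a b : ℝ} (hab : a ≤ b)
    (h : ∀ t, a ≤ t → HasDerivAt f (f' t) t) (h' : ∀ t, a ≤ t → f' t ≤ 0) : f b ≤ f a := by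
  refine antitoneOn_of_deriv_nonpos (convex_Ici a)
    (fun t ht => (h t ht).continuousAt.continuousWithinAt)
    (fun t ht => (h t (interior_subset ht)).differentiableAt.differentiableWithinAt)
    (fun t ht => ?_) (mem_Ici.2 le_rfl) (mem_Ici.2 hab) hab
  rw [(h t (interior_subset ht)).deriv]
  exact h' t (interior_subset ht)

namespace IsBesselPair

variable {ν : ℝ} {u v : ℝ → ℝ}

lemma hasDerivAt_energy (h : IsBesselPair ν u v) {t : ℝ} (ht : 0 < t) :
    HasDerivAt (fun t => t * (u t ^ 2 + v t ^ 2)) ((2 * ν + 1) * (u t ^ 2 - v t ^ 2)) t := by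
  refine ((hasDerivAt_id t).mul (((h.fst t ht).pow 2).add ((h.snd t ht).pow 2))).congr_deriv ?_
  simp only [id, Pi.add_apply, Pi.pow_apply, Nat.cast_ofNat, Nat.add_one_sub_one, pow_one]
  field_simp
  ring

lemma hasDerivAt_mul (h : IsBesselPair ν u v) {t : ℝ} (ht : 0 < t) :
    HasDerivAt (fun t => u t * v t) (u t ^ 2 - v t ^ 2 - u t * v t / t) t := by
  refine ((h.fst t ht).mul (h.snd t ht)).congr_deriv ?_
  field_simp
  ring

lemma energy_le_of_le (h : IsBesselPair ν u v) {R x t : ℝ} (hR : |2 * ν + 1| ≤ R)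
    (hx : 0 < x) (ht : x ≤ t) :
    t * (u t ^ 2 + v t ^ 2) ≤ Real.exp (R / x * (t - x)) * (x * (u x ^ 2 + v x ^ 2)) := by
  have key := le_of_forall_hasDerivAt_nonpos
    (f := fun s => Real.exp (-(R / x * (s - x))) * (s * (u s ^ 2 + v s ^ 2))) ht
    (fun s hs => ((((((hasDerivAt_id s).sub_const x).const_mul (R / x)).neg).exp).mul
      (h.hasDerivAt_energy (hx.trans_le hs)))) (fun s hs => by
      have hs0 : 0 < s := hx.trans_le hs
      have h1 : (2 * ν + 1) * (u s ^ 2 - v s ^ 2) ≤ R * (u s ^ 2 + v s ^ 2) := by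
        have := abs_le.1 hR
        nlinarith [sq_nonneg (u s), sq_nonneg (v s)]
      have hR0 : 0 ≤ R := (abs_nonneg _).trans hR
      have h2 : R * (u s ^ 2 + v s ^ 2) ≤ R / x * (s * (u s ^ 2 + v s ^ 2)) := by
        rw [div_mul_eq_mul_div, le_div_iff₀ hx]
        have : 0 ≤ R * (u s ^ 2 + v s ^ 2) := by positivity
        nlinarith
      have h3 := Real.exp_pos (-(R / x * (s - x)))
      simp only [id, Pi.neg_apply]
      nlinarith)
  simp only [sub_self, mul_zero, neg_zero, Real.exp_zero, one_mul] at key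
  rw [Real.exp_neg] at key
  rwa [inv_mul_le_iff₀ (Real.exp_pos _)] at key

lemma energy_le_of_ge (h : IsBesselPair ν u v) {R s t : ℝ} (hR : |2 * ν + 1| ≤ R)
    (hs0 : 0 < s) (hs : R ≤ s) (ht : s ≤ t) :
    t * (u t ^ 2 + v t ^ 2) ≤ 9 * (s * (u s ^ 2 + v s ^ 2)) := by
  have hR0 : 0 ≤ R := (abs_nonneg _).trans hR
  have cross : ∀ r, |(2 * ν + 1) * (u r * v r)| ≤ R / 2 * (u r ^ 2 + v r ^ 2) := by
    intro r
    rw [abs_mul]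
    have h1 : |u r * v r| ≤ (u r ^ 2 + v r ^ 2) / 2 := by
      rw [abs_le]; constructor <;> nlinarith [sq_nonneg (u r + v r), sq_nonneg (u r - v r)]
    calc _ ≤ R * ((u r ^ 2 + v r ^ 2) / 2) := by gcongr
      _ = _ := by ring
  have key := le_of_forall_hasDerivAt_nonpos
    (f := fun r => Real.exp (R * r⁻¹) * (r * (u r ^ 2 + v r ^ 2) - (2 * ν + 1) * (u r * v r))) ht
    (fun r hr => (((hasDerivAt_inv (hs0.trans_le hr).ne').const_mul R).exp).mul
      ((h.hasDerivAt_energy (hs0.trans_le hr)).sub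
        ((h.hasDerivAt_mul (hs0.trans_le hr)).const_mul (2 * ν + 1)))) (fun r hr => by
      have hr0 : 0 < r := hs0.trans_le hr
      have h1 := abs_le.1 (cross r)
      have h2 : R ≤ r := hs.trans hr
      have h3 := Real.exp_pos (R * r⁻¹)
      have h4 : (2 * ν + 1) * (u r * v r) / r ≤ R / r ^ 2 *
          (r * (u r ^ 2 + v r ^ 2) - (2 * ν + 1) * (u r * v r)) := by
        rw [div_mul_eq_mul_div, div_le_div_iff₀ hr0 (by positivity)]
        have h5 : r / 2 * (u r ^ 2 + v r ^ 2) ≤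
            r * (u r ^ 2 + v r ^ 2) - (2 * ν + 1) * (u r * v r) := by
          nlinarith [sq_nonneg (u r), sq_nonneg (v r)]
        calc (2 * ν + 1) * (u r * v r) * r ^ 2 ≤ R / 2 * (u r ^ 2 + v r ^ 2) * r ^ 2 := by
              exact mul_le_mul_of_nonneg_right h1.2 (by positivity)
          _ = R * (r / 2 * (u r ^ 2 + v r ^ 2)) * r := by ring
          _ ≤ _ := by gcongr
      have h6 : Real.exp (R * r⁻¹) * (R * -(r ^ 2)⁻¹) *
            (r * (u r ^ 2 + v r ^ 2) - (2 * ν + 1) * (u r * v r)) +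
          Real.exp (R * r⁻¹) * ((2 * ν + 1) * (u r ^ 2 - v r ^ 2) -
            (2 * ν + 1) * (u r ^ 2 - v r ^ 2 - u r * v r / r)) =
          Real.exp (R * r⁻¹) * ((2 * ν + 1) * (u r * v r) / r - R / r ^ 2 *
          (r * (u r ^ 2 + v r ^ 2) - (2 * ν + 1) * (u r * v r))) := by ring
      refine h6.trans_le ?_
      exact mul_nonpos_of_nonneg_of_nonpos h3.le (by linarith))
  have ht0 : 0 < t := hs0.trans_le ht
  have c1 := abs_le.1 (cross t)
  have c2 := abs_le.1 (cross s)
  have e1 : 1 ≤ Real.exp (R * t⁻¹) := Real.one_le_exp (by positivity)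
  have e2 : Real.exp (R * s⁻¹) ≤ 3 := by
    have : R * s⁻¹ ≤ 1 := by rw [← div_eq_mul_inv, div_le_one hs0]; exact hs
    exact (Real.exp_le_exp.2 this).trans (Real.exp_one_lt_d9.le.trans (by norm_num))
  have p1 : t / 2 * (u t ^ 2 + v t ^ 2) ≤
      t * (u t ^ 2 + v t ^ 2) - (2 * ν + 1) * (u t * v t) := by
    have : R * (u t ^ 2 + v t ^ 2) ≤ t * (u t ^ 2 + v t ^ 2) := by gcongr; linarith
    linarith
  have p2 : s * (u s ^ 2 + v s ^ 2) - (2 * ν + 1) * (u s * v s) ≤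
      3 / 2 * (s * (u s ^ 2 + v s ^ 2)) := by
    have : R * (u s ^ 2 + v s ^ 2) ≤ s * (u s ^ 2 + v s ^ 2) := by gcongr
    linarith
  have q0 : 0 ≤ t / 2 * (u t ^ 2 + v t ^ 2) := by positivity
  calc t * (u t ^ 2 + v t ^ 2) = 2 * (1 * (t / 2 * (u t ^ 2 + v t ^ 2))) := by ring
    _ ≤ 2 * (Real.exp (R * t⁻¹) * (t * (u t ^ 2 + v t ^ 2) - (2 * ν + 1) * (u t * v t))) := by
      gcongr
    _ ≤ 2 * (Real.exp (R * s⁻¹) * (s * (u s ^ 2 + v s ^ 2) - (2 * ν + 1) * (u s * v s))) := by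
      gcongr
    _ ≤ 2 * (Real.exp (R * s⁻¹) * (3 / 2 * (s * (u s ^ 2 + v s ^ 2)))) := by gcongr
    _ ≤ 2 * (3 * (3 / 2 * (s * (u s ^ 2 + v s ^ 2)))) := by gcongr
    _ = _ := by ring

end IsBesselPair

/-- Bessel pairs decay like `t ^ (-1/2)`, uniformly in the order. -/
lemma exists_energy_le (R : ℝ) {x : ℝ} (hx : 0 < x) :
    ∃ C : ℝ, 0 ≤ C ∧ ∀ (ν : ℝ) (u v : ℝ → ℝ), |2 * ν + 1| ≤ R → IsBesselPair ν u v →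
      ∀ t, x ≤ t → t * (u t ^ 2 + v t ^ 2) ≤ C * (u x ^ 2 + v x ^ 2) := by
  set s := max x R with hs
  have hxs : x ≤ s := le_max_left _ _
  refine ⟨9 * (Real.exp (|R| / x * (s - x)) * x), by positivity, fun ν u v hR h t ht => ?_⟩
  have hR' : |2 * ν + 1| ≤ |R| := hR.trans (le_abs_self R)
  have base := fun r (h1 : x ≤ r) (h2 : r ≤ s) => (h.energy_le_of_le hR' hx h1).trans
    (mul_le_mul_of_nonneg_right (Real.exp_le_exp.2 (by gcongr :
      |R| / x * (r - x) ≤ |R| / x * (s - x))) (by positivity))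
  have h0 : 0 ≤ Real.exp (|R| / x * (s - x)) * (x * (u x ^ 2 + v x ^ 2)) := by positivity
  rcases le_total t s with hts | hts
  · linarith [base t ht hts]
  · have := h.energy_le_of_ge hR (hx.trans_le hxs) (le_max_right _ _) hts
    linarith [base s hxs le_rfl]

lemma exists_norm_sub_le_of_deriv_le {G G' : ℝ → ℂ} {K : ℝ}
    (h : ∀ t, 1 ≤ t → HasDerivAt G (G' t) t) (h' : ∀ t, 1 ≤ t → ‖G' t‖ ≤ K / t ^ 2) :
    ∃ c : ℂ, ∀ t, 1 ≤ t → ‖G t - c‖ ≤ K / t := by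
  have hK : 0 ≤ K := by simpa using (norm_nonneg _).trans (h' 1 le_rfl)
  have key : ∀ s t, 1 ≤ s → s ≤ t → ‖G t - G s‖ ≤ K / s := by
    intro s t hs hst
    have := image_norm_le_of_norm_deriv_right_le_deriv_boundary' (a := s) (b := t)
      (f := fun r => G r - G s) (f' := G') (B := fun r => K / s - K * r⁻¹)
      (B' := fun r => K / r ^ 2)
      (fun r hr => ((h r (hs.trans hr.1)).sub_const _).continuousAt.continuousWithinAt)
      (fun r hr => ((h r (hs.trans hr.1)).sub_const _).hasDerivWithinAt) (by simp [div_eq_mul_inv])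
      (fun r hr => ((((hasDerivAt_inv (by linarith [hr.1] : r ≠ 0)).const_mul K).const_sub
        (K / s)).continuousAt).continuousWithinAt)
      (fun r hr => ((((hasDerivAt_inv (by linarith [hr.1] : r ≠ 0)).const_mul K).const_sub
        (K / s)).congr_deriv (by ring)).hasDerivWithinAt)
      (fun r hr => h' r (hs.trans hr.1)) (right_mem_Icc.2 hst)
    refine this.trans ?_
    have : 0 ≤ K * t⁻¹ := mul_nonneg hK (inv_nonneg.2 (by linarith))
    linarith
  have hc : CauchySeq G := by
    refine Metric.cauchySeq_iff'.2 fun ε hε => ?_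
    have h1 : Tendsto (fun s : ℝ => K / s) atTop (𝓝 0) := tendsto_const_nhds.div_atTop tendsto_id
    obtain ⟨s, hs1, hs2⟩ :=
      ((h1.eventually (gt_mem_nhds hε)).and (eventually_ge_atTop 1)).exists
    exact ⟨s, fun t ht => by rw [dist_eq_norm]; exact (key s t hs2 ht).trans_lt hs1⟩
  obtain ⟨c, hc⟩ := cauchySeq_tendsto_of_complete hc
  refine ⟨c, fun t ht => ?_⟩
  have h1 : Tendsto (fun s => ‖G t - G s‖) atTop (𝓝 ‖G t - c‖) := (tendsto_const_nhds.sub hc).norm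
  refine le_of_tendsto h1 ?_
  filter_upwards [eventually_ge_atTop t] with s hs
  rw [norm_sub_rev]
  exact key t s ht hs

/-- The oscillatory asymptotics of a Bessel pair at infinity. -/
lemma IsBesselPair.exists_asymptotic {ν : ℝ} {u v : ℝ → ℝ} (h : IsBesselPair ν u v) :
    ∃ (c : ℂ) (K : ℝ), ∀ t, 1 ≤ t →
      |√t * u t - (c * Complex.exp (t * Complex.I)).re| ≤ K / t := by
  obtain ⟨C, hC, hE⟩ := exists_energy_le |2 * ν + 1| one_pos
  set B := √(C * (u 1 ^ 2 + v 1 ^ 2)) with hB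
  set a := ν + 1 / 2 with ha
  set w : ℝ → ℂ := fun t => (√t * u t : ℝ) + (√t * v t : ℝ) * Complex.I with hw
  set w' : ℝ → ℂ := fun t => (√t * u t : ℝ) - (√t * v t : ℝ) * Complex.I with hw'
  have dU : ∀ t, 0 < t → HasDerivAt (fun t => √t * u t) (a / t * (√t * u t) - √t * v t) t := by
    intro t ht
    refine ((Real.hasDerivAt_sqrt ht.ne').mul (h.fst t ht)).congr_deriv ?_
    have h2 := Real.sq_sqrt ht.le
    have h3 := Real.sqrt_pos.2 ht
    have h4 : 1 / (2 * √t) = √t / (2 * t) := by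
      rw [div_eq_div_iff (by positivity) (by positivity)]; linear_combination -2 * h2
    rw [h4]; field_simp; ring
  have dV : ∀ t, 0 < t → HasDerivAt (fun t => √t * v t) (√t * u t - a / t * (√t * v t)) t := by
    intro t ht
    refine ((Real.hasDerivAt_sqrt ht.ne').mul (h.snd t ht)).congr_deriv ?_
    have h2 := Real.sq_sqrt ht.le
    have h3 := Real.sqrt_pos.2 ht
    have h4 : 1 / (2 * √t) = √t / (2 * t) := by
      rw [div_eq_div_iff (by positivity) (by positivity)]; linear_combination -2 * h2
    rw [h4]; field_simp; ring
  have dw : ∀ t, 0 < t → HasDerivAt w (Complex.I * w t + a / t * w' t) t := by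
    intro t ht
    refine ((dU t ht).ofReal_comp.add ((dV t ht).ofReal_comp.mul_const Complex.I)).congr_deriv ?_
    simp only [hw, hw']; push_cast
    linear_combination (-(√t * v t : ℂ)) * Complex.I_sq
  have dw' : ∀ t, 0 < t → HasDerivAt w' (-Complex.I * w' t + a / t * w t) t := by
    intro t ht
    refine ((dU t ht).ofReal_comp.sub ((dV t ht).ofReal_comp.mul_const Complex.I)).congr_deriv ?_
    simp only [hw, hw']; push_cast
    linear_combination (-(√t * v t : ℂ)) * Complex.I_sq
  have nw : ∀ t, 1 ≤ t → ‖w t‖ ≤ B := by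
    intro t ht
    rw [Complex.norm_add_mul_I, hB]
    refine Real.sqrt_le_sqrt ((hE ν u v le_rfl h t ht).trans' (le_of_eq ?_))
    rw [mul_pow, mul_pow, Real.sq_sqrt (by linarith)]; ring
  have nw' : ∀ t, 1 ≤ t → ‖w' t‖ ≤ B := by
    intro t ht
    have : w' t = (√t * u t : ℝ) + (-(√t * v t) : ℝ) * Complex.I := by
      simp only [hw']; push_cast; ring
    rw [this, Complex.norm_add_mul_I, hB]
    refine Real.sqrt_le_sqrt ((hE ν u v le_rfl h t ht).trans' (le_of_eq ?_))
    rw [neg_sq, mul_pow, mul_pow, Real.sq_sqrt (by linarith)]; ring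
  have dexp : ∀ t : ℝ, HasDerivAt (fun t : ℝ => Complex.exp (-(t * Complex.I)))
      (-Complex.I * Complex.exp (-(t * Complex.I))) t := by
    intro t
    refine (((Complex.ofRealCLM.hasDerivAt (x := t)).mul_const Complex.I).neg.cexp).congr_deriv ?_
    simp
    ring
  have nexp : ∀ t : ℝ, ‖Complex.exp (-(t * Complex.I))‖ = 1 := by
    intro t
    rw [show -((t : ℂ) * Complex.I) = ((-t : ℝ) : ℂ) * Complex.I by push_cast; ring,
      Complex.norm_exp_ofReal_mul_I]
  have B0 : 0 ≤ B := Real.sqrt_nonneg _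
  obtain ⟨c, hc⟩ := exists_norm_sub_le_of_deriv_le (K := (|a| + a ^ 2) / 2 * B)
    (G := fun t => Complex.exp (-(t * Complex.I)) *
      (w t - a * Complex.I / 2 * ((t⁻¹ : ℝ) : ℂ) * w' t))
    (G' := fun t => Complex.exp (-(t * Complex.I)) *
      ((a * Complex.I / (2 * t ^ 2)) * w' t - a ^ 2 * Complex.I / (2 * t ^ 2) * w t))
    (fun t ht => by
      have ht0 : 0 < t := by linarith
      have ht0' : (t : ℂ) ≠ 0 := by exact_mod_cast ht0.ne'
      refine ((dexp t).mul ((dw t ht0).sub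
        (((hasDerivAt_inv ht0.ne').ofReal_comp.const_mul (a * Complex.I / 2 : ℂ)).mul
          (dw' t ht0)))).congr_deriv ?_
      simp only [Pi.sub_apply, Pi.mul_apply]
      push_cast
      field_simp
      ring_nf
      simp only [Complex.I_sq]
      ring)
    (fun t ht => by
      have ht0 : 0 < t := by linarith
      rw [norm_mul, nexp, one_mul]
      refine (norm_sub_le _ _).trans ?_
      simp only [norm_mul, norm_div, norm_pow, Complex.norm_real, Complex.norm_I, mul_one,
        Complex.norm_ofNat, Real.norm_eq_abs, abs_of_pos ht0, sq_abs]
      have e1 := mul_le_mul_of_nonneg_left (nw' t ht) (by positivity : 0 ≤ |a| / (2 * t ^ 2))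
      have e2 := mul_le_mul_of_nonneg_left (nw t ht) (by positivity : 0 ≤ a ^ 2 / (2 * t ^ 2))
      refine (add_le_add e1 e2).trans (le_of_eq ?_)
      field_simp)
  refine ⟨c, (|a| + a ^ 2) / 2 * B + |a| / 2 * B, fun t ht => ?_⟩
  have ht0 : 0 < t := by linarith
  set e := Complex.exp (t * Complex.I) with he
  have ee : e * Complex.exp (-(t * Complex.I)) = 1 := by
    rw [he, ← Complex.exp_add]; simp
  have ne : ‖e‖ = 1 := Complex.norm_exp_ofReal_mul_I t
  have h1 := hc t ht
  have h2 : w t - c * e = e * (Complex.exp (-(t * Complex.I)) *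
      (w t - a * Complex.I / 2 * ((t⁻¹ : ℝ) : ℂ) * w' t) - c) +
      a * Complex.I / 2 * ((t⁻¹ : ℝ) : ℂ) * w' t := by
    linear_combination (-(w t - a * Complex.I / 2 * ((t⁻¹ : ℝ) : ℂ) * w' t)) * ee
  have h3 : √t * u t - (c * e).re = (w t - c * e).re := by
    simp [hw]
  rw [h3]
  refine (Complex.abs_re_le_norm _).trans ?_
  rw [h2]
  refine (norm_add_le _ _).trans ?_
  rw [norm_mul, ne, one_mul, add_div]
  refine add_le_add h1 ?_
  simp only [norm_mul, norm_div, Complex.norm_real, Complex.norm_I, mul_one,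
        Complex.norm_ofNat, Real.norm_eq_abs, abs_inv, abs_of_pos ht0]
  calc |a| / 2 * t⁻¹ * ‖w' t‖ ≤ |a| / 2 * t⁻¹ * B := by gcongr; exact nw' t ht
    _ = _ := by ring

/-- The function `besselSeries` at complex order. -/
noncomputable def besselSeriesC (y : ℝ) (z : ℂ) : ℂ :=
  ∑' k : ℕ, ((-y) ^ k / k.factorial : ℝ) * (Complex.Gamma (z + k + 1))⁻¹

lemma summable_abs_pow_div_factorial (M y : ℝ) :
    Summable fun k : ℕ => |y| ^ k / k.factorial * M :=
  (Real.summable_pow_div_factorial |y|).mul_right M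

lemma differentiable_besselSeriesC (y : ℝ) : Differentiable ℂ (besselSeriesC y) := by
  intro z
  obtain ⟨M, hM, h⟩ := exists_norm_inv_Gamma_le (‖z‖ + 1)
  have := Complex.differentiableOn_tsum_of_summable_norm (U := Metric.ball 0 (‖z‖ + 1))
    (F := fun (k : ℕ) (z : ℂ) =>
      (((-y) ^ k / k.factorial : ℝ) : ℂ) * (Complex.Gamma (z + k + 1))⁻¹)
    (summable_abs_pow_div_factorial M y)
    (fun k => ((Complex.differentiable_one_div_Gamma.comp
      (by fun_prop : Differentiable ℂ fun z : ℂ => z + k + 1)).const_mul _).differentiableOn)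
    Metric.isOpen_ball (fun k w hw => by
      rw [norm_mul, Complex.norm_real, norm_div, norm_pow, norm_neg, Real.norm_eq_abs,
        Real.norm_natCast]
      exact mul_le_mul_of_nonneg_left (h w (mem_ball_zero_iff.1 hw).le k) (by positivity))
  exact this.differentiableAt (Metric.isOpen_ball.mem_nhds (mem_ball_zero_iff.2 (by linarith)))

lemma besselSeriesC_ofReal (ν y : ℝ) : besselSeriesC y ν = (besselSeries ν y : ℂ) := by
  unfold besselSeriesC besselSeries
  rw [Complex.ofReal_tsum]
  refine tsum_congr fun k => ?_
  rw [show (ν : ℂ) + k + 1 = ((ν + k + 1 : ℝ) : ℂ) by push_cast; ring, Complex.Gamma_ofReal]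
  push_cast
  rw [neg_pow]; ring

lemma contDiff_besselSeries (y : ℝ) : ContDiff ℝ 1 fun ν => besselSeries ν y := by
  have h1 : ContDiff ℂ 1 (besselSeriesC y) := (differentiable_besselSeriesC y).contDiff
  have h2 : ContDiff ℝ 1 fun ν : ℝ => Complex.reCLM (besselSeriesC y (Complex.ofRealCLM ν)) :=
    Complex.reCLM.contDiff.comp ((h1.restrict_scalars ℝ).comp Complex.ofRealCLM.contDiff)
  have h3 : (fun ν => besselSeries ν y) =
      fun ν : ℝ => Complex.reCLM (besselSeriesC y (Complex.ofRealCLM ν)) := by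
    ext ν; simp [besselSeriesC_ofReal]
  rwa [h3]

lemma contDiff_besselJ {x : ℝ} (hx : 0 < x) : ContDiff ℝ 1 fun ν => besselJ ν x := by
  have h2 : (0 : ℝ) < x / 2 := by positivity
  have h3 : (fun ν => besselJ ν x) =
      fun ν => Real.exp (Real.log (x / 2) * ν) * besselSeries ν (x ^ 2 / 4) := by
    ext ν; rw [besselJ_eq, Real.rpow_def_of_pos h2]
  rw [h3]
  exact (Real.contDiff_exp.comp (contDiff_const.mul contDiff_id)).mul
    (contDiff_besselSeries (x ^ 2 / 4))

lemma besselJ_neg_natCast (n : ℕ) {x : ℝ} (hx : 0 < x) :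
    besselJ (-n) x = (-1) ^ n * besselJ n x := by
  induction n using Nat.twoStepInduction with
  | zero => simp
  | one =>
    have := besselJ_recurrence 0 hx
    simp only [zero_sub, zero_add, mul_zero, zero_div, zero_mul] at this
    simp only [Nat.cast_one, pow_one]
    linarith
  | more n h1 h2 =>
    have r1 := besselJ_recurrence (n + 1) hx
    have r2 := besselJ_recurrence (-(n + 1)) hx
    push_cast at h2 ⊢
    rw [show (n : ℝ) + 1 - 1 = n by ring, show (n : ℝ) + 1 + 1 = n + 2 by ring] at r1
    rw [show -((n : ℝ) + 1) - 1 = -(n + 2) by ring, show -((n : ℝ) + 1) + 1 = -n by ring] at r2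
    rw [h1, h2] at r2
    rw [pow_succ] at h2 r2
    rw [pow_succ, pow_succ]
    linear_combination r2 - (-1) ^ n * r1

lemma besselJ_mul_cos_sub_eq_zero (n : ℤ) {x : ℝ} (hx : 0 < x) :
    besselJ n x * Real.cos (n * Real.pi) - besselJ (-n) x = 0 := by
  rw [Real.cos_int_mul_pi]
  obtain ⟨m, rfl | rfl⟩ := n.eq_nat_or_neg
  · simp [besselJ_neg_natCast m hx]; ring
  · have h1 : ((-1 : ℝ) ^ m) * (-1) ^ m = 1 := by rw [← mul_pow]; simp
    have h2 : ((-1 : ℝ) ^ m)⁻¹ = (-1) ^ m := inv_eq_of_mul_eq_one_left h1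
    push_cast
    rw [neg_neg, besselJ_neg_natCast m hx, zpow_neg, zpow_natCast, h2]
    linear_combination besselJ m x * h1

/-- The quotient defining the Bessel function of the second kind at non-integer orders. -/
noncomputable def besselYQuot (μ x : ℝ) : ℝ :=
  (besselJ μ x * Real.cos (μ * Real.pi) - besselJ (-μ) x) / Real.sin (μ * Real.pi)

/-- The set of non-integer reals. -/
def nonIntegers : Set ℝ := {μ : ℝ | ∀ n : ℤ, μ ≠ (n : ℝ)}

lemma sin_mul_pi_ne_zero {μ : ℝ} (h : μ ∈ nonIntegers) : Real.sin (μ * Real.pi) ≠ 0 := by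
  intro h0
  obtain ⟨n, hn⟩ := Real.sin_eq_zero_iff.1 h0
  exact h n (mul_right_cancel₀ Real.pi_ne_zero hn).symm

lemma nhdsWithin_nonIntegers_neBot (ν : ℝ) : (𝓝[nonIntegers] ν).NeBot := by
  rw [← mem_closure_iff_nhdsWithin_neBot]
  have : nonIntegers = (range ((↑) : ℤ → ℝ))ᶜ := by
    ext μ; simp [nonIntegers, eq_comm]
  rw [this]
  exact (countable_range _).dense_compl ℝ ν

lemma differentiableAt_besselJ_order {x : ℝ} (hx : 0 < x) (ν : ℝ) :
    DifferentiableAt ℝ (fun ν => besselJ ν x) ν :=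
  (contDiff_besselJ hx).differentiable one_ne_zero ν

lemma differentiable_besselYQuot_num {x : ℝ} (hx : 0 < x) :
    Differentiable ℝ fun μ => besselJ μ x * Real.cos (μ * Real.pi) - besselJ (-μ) x := by
  intro μ
  have h1 := differentiableAt_besselJ_order hx μ
  have h2 : DifferentiableAt ℝ (fun μ => besselJ (-μ) x) μ :=
    (differentiableAt_besselJ_order hx (-μ)).comp μ differentiableAt_id.neg
  fun_prop

/-- The limit defining the Bessel function of the second kind exists at every order. -/
lemma tendsto_besselYQuot (ν : ℝ) {x : ℝ} (hx : 0 < x) :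
    Tendsto (fun μ => besselYQuot μ x) (𝓝[nonIntegers] ν) (𝓝 (besselY ν x)) := by
  have := nhdsWithin_nonIntegers_neBot ν
  refine tendsto_nhds_limUnder ?_
  change ∃ y, Tendsto (fun μ => besselYQuot μ x) (𝓝[nonIntegers] ν) (𝓝 y)
  by_cases hν : ν ∈ nonIntegers
  · refine ⟨besselYQuot ν x, Tendsto.mono_left ?_ nhdsWithin_le_nhds⟩
    refine ((differentiable_besselYQuot_num hx ν).continuousAt).div ?_ (sin_mul_pi_ne_zero hν)
    fun_prop
  · obtain ⟨n, rfl⟩ : ∃ n : ℤ, ν = n := by simpa [nonIntegers] using hν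
    have hsub : 𝓝[nonIntegers] (n : ℝ) ≤ 𝓝[≠] (n : ℝ) := nhdsWithin_mono _ fun μ hμ => hμ n
    have h1 := (hasDerivAt_iff_tendsto_slope.1
      (differentiable_besselYQuot_num hx (n : ℝ)).hasDerivAt).mono_left hsub
    have h2 := (hasDerivAt_iff_tendsto_slope.1
      (((hasDerivAt_id (n : ℝ)).mul_const Real.pi).sin)).mono_left hsub
    have hne : Real.cos ((n : ℝ) * Real.pi) * (1 * Real.pi) ≠ 0 := by
      rw [Real.cos_int_mul_pi]
      exact mul_ne_zero (zpow_ne_zero _ (by norm_num)) (by simp [Real.pi_ne_zero])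
    refine ⟨_, (h1.div h2 hne).congr' ?_⟩
    filter_upwards [self_mem_nhdsWithin] with μ hμ
    have hμn : μ - n ≠ 0 := sub_ne_zero.2 (hμ n)
    simp only [Pi.div_apply, slope_def_field, id, besselJ_mul_cos_sub_eq_zero n hx,
      Real.sin_int_mul_pi, sub_zero]
    rw [besselYQuot]
    field_simp

lemma isBesselPair_besselYQuot {μ : ℝ} (hμ : μ ∈ nonIntegers) :
    IsBesselPair μ (besselYQuot μ) (besselYQuot (μ + 1)) := by
  have h := (isBesselPair_besselJ μ).linear_comb (isBesselPair_besselJ_neg μ)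
    (Real.cos (μ * Real.pi) / Real.sin (μ * Real.pi)) (-(1 / Real.sin (μ * Real.pi)))
  have hs := sin_mul_pi_ne_zero hμ
  convert h using 1
  · ext t; rw [besselYQuot]; field_simp; ring
  · ext t
    rw [besselYQuot, show (μ + 1) * Real.pi = μ * Real.pi + Real.pi by ring, Real.cos_add_pi,
      Real.sin_add_pi]
    field_simp; ring

lemma add_one_mem_nonIntegers {μ : ℝ} (hμ : μ ∈ nonIntegers) : μ + 1 ∈ nonIntegers := by
  intro n hn
  exact hμ (n - 1) (by push_cast; linarith)

lemma tendsto_add_one_nonIntegers (ν : ℝ) :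
    Tendsto (fun μ : ℝ => μ + 1) (𝓝[nonIntegers] ν) (𝓝[nonIntegers] (ν + 1)) := by
  refine tendsto_nhdsWithin_iff.2 ⟨?_, ?_⟩
  · exact ((continuous_id.add continuous_const).tendsto ν).mono_left nhdsWithin_le_nhds
  · filter_upwards [self_mem_nhdsWithin] with μ hμ using add_one_mem_nonIntegers hμ

lemma exists_abs_besselSeries_sq_le {ν : ℝ} (hν : 0 ≤ ν) :
    ∃ K : ℝ, 0 ≤ K ∧ ∀ z : ℝ, |besselSeries ν (z ^ 2 / 4)| ≤ K := by
  obtain ⟨M, hM, h⟩ := exists_abs_inv_Gamma_le |ν|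
  obtain ⟨C, hC, hE⟩ := exists_energy_le |2 * ν + 1| one_pos
  set D := C * (besselJ ν 1 ^ 2 + besselJ (ν + 1) 1 ^ 2) with hD
  have hD0 : 0 ≤ D := by positivity
  refine ⟨max (M * Real.exp 1) (2 ^ ν * √D), le_max_of_le_left (by positivity), fun z => ?_⟩
  rw [← sq_abs z]
  have hw := abs_nonneg z
  generalize |z| = w at hw
  rcases le_total w 1 with h1 | h1
  · refine le_max_of_le_left ((abs_besselSeries_le (h ν le_rfl) (by positivity)).trans ?_)
    gcongr
    nlinarith
  · refine le_max_of_le_right ?_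
    have h0 : 0 < w := by linarith
    have e1 := hE ν _ _ le_rfl (isBesselPair_besselJ ν) w h1
    have e2 : besselJ ν w ^ 2 ≤ D := by
      nlinarith [sq_nonneg (besselJ (ν + 1) w), sq_nonneg (besselJ ν w)]
    have e3 := Real.abs_le_sqrt e2
    rw [besselJ_eq, abs_mul, Real.div_rpow h0.le (by norm_num), abs_of_pos (by positivity),
      div_mul_eq_mul_div, div_le_iff₀ (by positivity)] at e3
    have e4 : 1 ≤ w ^ ν := Real.one_le_rpow h1 hν
    nlinarith [abs_nonneg (besselSeries ν (w ^ 2 / 4))]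

lemma hasDerivAt_besselSeries_sq (ν z : ℝ) :
    HasDerivAt (fun z => besselSeries ν (z ^ 2 / 4)) (-(z / 2) * besselSeries (ν + 1) (z ^ 2 / 4))
      z := by
  refine ((hasDerivAt_besselSeries ν (z ^ 2 / 4)).comp z
    (((hasDerivAt_id z).pow 2).div_const 4)).congr_deriv ?_
  simp
  ring

lemma continuous_besselSeries_sq (ν : ℝ) : Continuous fun z => besselSeries ν (z ^ 2 / 4) :=
  continuous_iff_continuousAt.2 fun z => (hasDerivAt_besselSeries_sq ν z).continuousAt

lemma integrableOn_exp_neg_mul_rpow {b : ℝ} (hb : 0 < b + 1) :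
    IntegrableOn (fun s : ℝ => Real.exp (-s) * s ^ b) (Ioi 0) := by
  simpa using Real.GammaIntegral_convergent hb

lemma norm_cexp_neg_one_add_mul (l s : ℝ) :
    ‖Complex.exp (-(1 + Complex.I * l) * s)‖ = Real.exp (-s) := by
  rw [Complex.norm_exp]; simp

/-- The integrand of a Laplace transform of the Bessel function. -/
noncomputable def besselLaplaceKernel (ν l s : ℝ) : ℂ :=
  (s ^ (2 * ν) : ℝ) * Complex.exp (-(1 + Complex.I * l) * s) * besselSeries ν ((l * s) ^ 2 / 4)

noncomputable def besselLaplaceKernelDeriv (ν l s : ℝ) : ℂ :=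
  (s ^ (2 * ν) : ℝ) * Complex.exp (-(1 + Complex.I * l) * s) *
    (-Complex.I * s * besselSeries ν ((l * s) ^ 2 / 4) -
      l * s ^ 2 / 2 * besselSeries (ν + 1) ((l * s) ^ 2 / 4))

lemma continuous_besselLaplaceKernel {ν : ℝ} (hν : 0 ≤ ν) (l : ℝ) :
    Continuous (besselLaplaceKernel ν l) := by
  have h1 : Continuous fun s : ℝ => s ^ (2 * ν) := Real.continuous_rpow_const (by positivity)
  have h2 : Continuous fun s => besselSeries ν ((l * s) ^ 2 / 4) :=
    (continuous_besselSeries_sq ν).comp (continuous_const.mul continuous_id)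
  unfold besselLaplaceKernel
  fun_prop

lemma continuous_besselLaplaceKernelDeriv {ν : ℝ} (hν : 0 ≤ ν) (l : ℝ) :
    Continuous (besselLaplaceKernelDeriv ν l) := by
  have h1 : Continuous fun s : ℝ => s ^ (2 * ν) := Real.continuous_rpow_const (by positivity)
  have h2 : ∀ ν, Continuous fun s => besselSeries ν ((l * s) ^ 2 / 4) := fun ν =>
    (continuous_besselSeries_sq ν).comp (continuous_const.mul continuous_id)
  have h3 := h2 ν
  have h4 := h2 (ν + 1)
  unfold besselLaplaceKernelDeriv
  fun_prop

lemma hasDerivAt_besselLaplaceKernel (ν l s : ℝ) :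
    HasDerivAt (fun l => besselLaplaceKernel ν l s) (besselLaplaceKernelDeriv ν l s) l := by
  have h1 : HasDerivAt (fun l : ℝ => Complex.exp (-(1 + Complex.I * l) * s))
      (-Complex.I * s * Complex.exp (-(1 + Complex.I * l) * s)) l := by
    refine (((((Complex.ofRealCLM.hasDerivAt (x := l)).const_mul Complex.I).const_add
      1).neg.mul_const (s : ℂ)).cexp).congr_deriv ?_
    simp; ring
  have h2 : HasDerivAt (fun l => besselSeries ν ((l * s) ^ 2 / 4))
      (-(l * s / 2) * besselSeries (ν + 1) ((l * s) ^ 2 / 4) * s) l := by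
    refine ((hasDerivAt_besselSeries_sq ν (l * s)).comp l
      ((hasDerivAt_id l).mul_const s)).congr_deriv ?_
    simp
  refine ((h1.const_mul ((s ^ (2 * ν) : ℝ) : ℂ)).mul h2.ofReal_comp).congr_deriv ?_
  unfold besselLaplaceKernelDeriv
  push_cast
  ring

lemma norm_besselLaplaceKernel_le {ν K : ℝ} (h : ∀ z : ℝ, |besselSeries ν (z ^ 2 / 4)| ≤ K)
    (l : ℝ) {s : ℝ} (hs : 0 < s) :
    ‖besselLaplaceKernel ν l s‖ ≤ K * (Real.exp (-s) * s ^ (2 * ν)) := by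
  unfold besselLaplaceKernel
  rw [norm_mul, norm_mul, norm_cexp_neg_one_add_mul, Complex.norm_real, Complex.norm_real,
    Real.norm_eq_abs, Real.norm_eq_abs, abs_of_pos (by positivity)]
  calc _ ≤ s ^ (2 * ν) * Real.exp (-s) * K := by gcongr; exact h _
    _ = _ := by ring

lemma norm_besselLaplaceKernelDeriv_le {ν K K' : ℝ}
    (h : ∀ z : ℝ, |besselSeries ν (z ^ 2 / 4)| ≤ K)
    (h' : ∀ z : ℝ, |besselSeries (ν + 1) (z ^ 2 / 4)| ≤ K') {l L : ℝ} (hl : |l| ≤ L)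
    {s : ℝ} (hs : 0 < s) :
    ‖besselLaplaceKernelDeriv ν l s‖ ≤ K * (Real.exp (-s) * s ^ (2 * ν + 1)) +
      L / 2 * K' * (Real.exp (-s) * s ^ (2 * ν + 2)) := by
  have hL : 0 ≤ L := (abs_nonneg _).trans hl
  unfold besselLaplaceKernelDeriv
  rw [norm_mul, norm_mul, norm_cexp_neg_one_add_mul, Complex.norm_real,
    Real.norm_eq_abs, abs_of_pos (by positivity), Real.rpow_add hs, Real.rpow_add hs, Real.rpow_one,
    Real.rpow_two]
  have : ‖-Complex.I * s * besselSeries ν ((l * s) ^ 2 / 4) -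
      l * s ^ 2 / 2 * besselSeries (ν + 1) ((l * s) ^ 2 / 4)‖ ≤ s * K + L * s ^ 2 / 2 * K' := by
    refine (norm_sub_le _ _).trans (add_le_add ?_ ?_)
    · simp only [norm_mul, norm_neg, Complex.norm_I, Complex.norm_real, Real.norm_eq_abs,
        abs_of_pos hs, one_mul]
      gcongr; exact h _
    · simp only [norm_mul, norm_div, norm_pow, Complex.norm_real, Real.norm_eq_abs,
        abs_of_pos hs, Complex.norm_ofNat]
      have := h' (l * s)
      gcongr
  calc _ ≤ s ^ (2 * ν) * Real.exp (-s) * (s * K + L * s ^ 2 / 2 * K') := by gcongr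
    _ = _ := by ring

/-- The antiderivative giving the first order equation of the Laplace transform. -/
lemma hasDerivAt_besselLaplacePrimitive {ν : ℝ} (l : ℝ) {s : ℝ} (hs : 0 < s) :
    HasDerivAt (fun s : ℝ => ((s ^ (2 * ν + 1) : ℝ) : ℂ) *
      Complex.exp (-(1 + Complex.I * l) * s) *
      (Complex.I * besselSeries ν ((l * s) ^ 2 / 4) +
        l * s / 2 * besselSeries (ν + 1) ((l * s) ^ 2 / 4)))
      ((1 + 2 * Complex.I * l) * besselLaplaceKernelDeriv ν l s +
        Complex.I * (2 * ν + 1) * besselLaplaceKernel ν l s) s := by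
  have h0 : HasDerivAt (fun s : ℝ => s ^ (2 * ν + 1)) ((2 * ν + 1) * s ^ (2 * ν)) s := by
    simpa using Real.hasDerivAt_rpow_const (p := 2 * ν + 1) (Or.inl hs.ne')
  have h1 : HasDerivAt (fun s : ℝ => Complex.exp (-(1 + Complex.I * l) * s))
      (-(1 + Complex.I * l) * Complex.exp (-(1 + Complex.I * l) * s)) s := by
    refine ((((Complex.ofRealCLM.hasDerivAt (x := s)).const_mul
      (-(1 + Complex.I * l)))).cexp).congr_deriv ?_
    simp; ring
  have h2 : ∀ ν, HasDerivAt (fun s => besselSeries ν ((l * s) ^ 2 / 4))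
      (-(l * s / 2) * besselSeries (ν + 1) ((l * s) ^ 2 / 4) * l) s := fun ν => by
    refine ((hasDerivAt_besselSeries_sq ν (l * s)).comp s
      ((hasDerivAt_id s).const_mul l)).congr_deriv ?_
    simp
  have h3 : HasDerivAt (fun s : ℝ => (l : ℂ) * s / 2) (l / 2) s := by
    refine (((Complex.ofRealCLM.hasDerivAt (x := s)).const_mul (l : ℂ)).div_const 2).congr_deriv ?_
    simp
  refine ((h0.ofReal_comp.mul h1).mul (((h2 ν).ofReal_comp.const_mul Complex.I).add
    (h3.mul (h2 (ν + 1)).ofReal_comp))).congr_deriv ?_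
  have hrec := congrArg (fun r : ℝ => (r : ℂ)) (besselSeries_recurrence (ν + 1) ((l * s) ^ 2 / 4))
  simp only [Pi.mul_apply, Pi.add_apply]
  unfold besselLaplaceKernel besselLaplaceKernelDeriv
  rw [Real.rpow_add hs, Real.rpow_one]
  simp only [add_sub_cancel_right] at hrec
  push_cast at hrec ⊢
  linear_combination ((l : ℂ) * s * besselSeries ν ((l * s) ^ 2 / 4) * (s ^ (2 * ν) : ℝ) *
    Complex.exp (-(1 + Complex.I * l) * s)) * Complex.I_sq -
    ((l : ℂ) * s * (s ^ (2 * ν) : ℝ) * Complex.exp (-(1 + Complex.I * l) * s)) * hrec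

lemma tendsto_exp_neg_mul_rpow_atTop (b : ℝ) :
    Tendsto (fun s : ℝ => Real.exp (-s) * s ^ b) atTop (𝓝 0) := by
  have := tendsto_rpow_mul_exp_neg_mul_atTop_nhds_zero b 1 one_pos
  refine this.congr fun s => ?_
  rw [mul_comm, neg_one_mul]

/-- A Laplace transform of the Bessel function. -/
noncomputable def besselLaplace (ν l : ℝ) : ℂ := ∫ s in Ioi (0 : ℝ), besselLaplaceKernel ν l s

lemma hasDerivAt_besselLaplace {ν : ℝ} (hν : 0 ≤ ν) (l : ℝ) :
    IntegrableOn (besselLaplaceKernelDeriv ν l) (Ioi 0) ∧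
    IntegrableOn (besselLaplaceKernel ν l) (Ioi 0) ∧
    HasDerivAt (besselLaplace ν) (∫ s in Ioi (0 : ℝ), besselLaplaceKernelDeriv ν l s) l := by
  obtain ⟨K, hK, h⟩ := exists_abs_besselSeries_sq_le hν
  obtain ⟨K', hK', h'⟩ := exists_abs_besselSeries_sq_le (by linarith : 0 ≤ ν + 1)
  have hint_ker : IntegrableOn (besselLaplaceKernel ν l) (Ioi 0) := by
    refine Integrable.mono'
      ((integrableOn_exp_neg_mul_rpow (by linarith : 0 < 2 * ν + 1)).const_mul K)
      (continuous_besselLaplaceKernel hν l).aestronglyMeasurable ?_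
    filter_upwards [ae_restrict_mem measurableSet_Ioi] with s hs
    exact norm_besselLaplaceKernel_le h l hs
  have key := hasDerivAt_integral_of_dominated_loc_of_deriv_le (𝕜 := ℝ)
    (μ := volume.restrict (Ioi (0 : ℝ))) (Metric.ball_mem_nhds l one_pos)
    (F := fun l s => besselLaplaceKernel ν l s) (F' := fun l s => besselLaplaceKernelDeriv ν l s)
    (bound := fun s => K * (Real.exp (-s) * s ^ (2 * ν + 1)) +
      (|l| + 1) / 2 * K' * (Real.exp (-s) * s ^ (2 * ν + 2)))
    (Eventually.of_forall fun l => (continuous_besselLaplaceKernel hν l).aestronglyMeasurable)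
    hint_ker (continuous_besselLaplaceKernelDeriv hν l).aestronglyMeasurable
    (by
      filter_upwards [ae_restrict_mem measurableSet_Ioi] with s hs r hr
      refine norm_besselLaplaceKernelDeriv_le h h' ?_ hs
      have := abs_sub_abs_le_abs_sub r l
      rw [Metric.mem_ball, Real.dist_eq] at hr
      linarith)
    (((integrableOn_exp_neg_mul_rpow (by linarith : 0 < 2 * ν + 1 + 1)).const_mul K).add
      ((integrableOn_exp_neg_mul_rpow (by linarith : 0 < 2 * ν + 2 + 1)).const_mul _))
    (Eventually.of_forall fun s l _ => hasDerivAt_besselLaplaceKernel ν l s)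
  exact ⟨key.1, hint_ker, key.2⟩

lemma integral_besselLaplaceKernelDeriv {ν : ℝ} (hν : 0 ≤ ν) (l : ℝ) :
    (1 + 2 * Complex.I * l) * (∫ s in Ioi (0 : ℝ), besselLaplaceKernelDeriv ν l s) +
      Complex.I * (2 * ν + 1) * besselLaplace ν l = 0 := by
  obtain ⟨i1, i2, -⟩ := hasDerivAt_besselLaplace hν l
  obtain ⟨K, hK, h⟩ := exists_abs_besselSeries_sq_le hν
  obtain ⟨K', hK', h'⟩ := exists_abs_besselSeries_sq_le (by linarith : 0 ≤ ν + 1)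
  have c1 : Continuous fun s : ℝ => s ^ (2 * ν + 1) := Real.continuous_rpow_const (by positivity)
  have c2 : ∀ ν, Continuous fun s => besselSeries ν ((l * s) ^ 2 / 4) := fun ν =>
    (continuous_besselSeries_sq ν).comp (continuous_const.mul continuous_id)
  have c3 := c2 ν
  have c4 := c2 (ν + 1)
  have e1 := i1.const_mul (1 + 2 * Complex.I * l)
  have e2 := i2.const_mul (Complex.I * (2 * ν + 1))
  have key := integral_Ioi_of_hasDerivAt_of_tendsto (m := 0)
    (by fun_prop) (fun s hs => hasDerivAt_besselLaplacePrimitive (ν := ν) l hs) (e1.add e2) (by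
      have t1 := ((tendsto_exp_neg_mul_rpow_atTop (2 * ν + 1)).const_mul K).add
        ((tendsto_exp_neg_mul_rpow_atTop (2 * ν + 2)).const_mul (|l| / 2 * K'))
      simp only [mul_zero, add_zero] at t1
      refine squeeze_zero_norm' ?_ t1
      filter_upwards [eventually_gt_atTop 0] with s hs
      rw [norm_mul, norm_mul, norm_cexp_neg_one_add_mul, Complex.norm_real,
        Real.norm_eq_abs, abs_of_pos (by positivity)]
      have : ‖Complex.I * besselSeries ν ((l * s) ^ 2 / 4) +
          l * s / 2 * besselSeries (ν + 1) ((l * s) ^ 2 / 4)‖ ≤ K + |l| * s / 2 * K' := by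
        refine (norm_add_le _ _).trans (add_le_add ?_ ?_)
        · simpa using h (l * s)
        · simp only [norm_mul, norm_div, Complex.norm_real, Real.norm_eq_abs,
            abs_of_pos hs, Complex.norm_ofNat]
          have := h' (l * s)
          gcongr
      calc _ ≤ s ^ (2 * ν + 1) * Real.exp (-s) * (K + |l| * s / 2 * K') := by gcongr
        _ = _ := by
          rw [show 2 * ν + 2 = 2 * ν + 1 + 1 by ring, Real.rpow_add_one hs.ne' (2 * ν + 1)]
          ring)
  rw [integral_add e1 e2, integral_const_mul, integral_const_mul] at key
  rw [besselLaplace, key, Real.zero_rpow (by positivity)]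
  simp

lemma one_add_two_I_mul_mem_slitPlane (l : ℝ) : 1 + 2 * Complex.I * l ∈ Complex.slitPlane := by
  refine Or.inl ?_
  simp

lemma besselLaplace_eq {ν : ℝ} (hν : 0 ≤ ν) (l : ℝ) :
    (1 + 2 * Complex.I * l) ^ ((ν : ℂ) + 1 / 2) * besselLaplace ν l =
      Real.Gamma (2 * ν + 1) / Real.Gamma (ν + 1) := by
  have hd : ∀ l : ℝ, HasDerivAt (fun l : ℝ =>
      (1 + 2 * Complex.I * l) ^ ((ν : ℂ) + 1 / 2) * besselLaplace ν l) 0 l := by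
    intro l
    have hm := one_add_two_I_mul_mem_slitPlane l
    have h1 : HasDerivAt (fun l : ℝ => 1 + 2 * Complex.I * (l : ℂ)) (2 * Complex.I) l := by
      refine (((Complex.ofRealCLM.hasDerivAt (x := l)).const_mul
        (2 * Complex.I)).const_add 1).congr_deriv ?_
      simp
    have h2 : HasDerivAt (fun l : ℝ => (1 + 2 * Complex.I * (l : ℂ)) ^ ((ν : ℂ) + 1 / 2))
        (((ν : ℂ) + 1 / 2) * (1 + 2 * Complex.I * (l : ℂ)) ^ ((ν : ℂ) + 1 / 2 - 1) *
          (2 * Complex.I)) l :=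
      HasDerivAt.comp (h₂ := fun z : ℂ => z ^ ((ν : ℂ) + 1 / 2)) (𝕜 := ℝ) (𝕜' := ℂ) l
        (Complex.hasStrictDerivAt_cpow_const hm).hasDerivAt h1
    refine (h2.mul (hasDerivAt_besselLaplace hν l).2.2).congr_deriv ?_
    have h3 := integral_besselLaplaceKernelDeriv hν l
    have hne := Complex.slitPlane_ne_zero hm
    rw [Complex.cpow_sub _ _ hne, Complex.cpow_one]
    generalize (1 + 2 * Complex.I * (l : ℂ)) ^ ((ν : ℂ) + 1 / 2) = w
    field_simp
    linear_combination w * h3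
  have hc := is_const_of_deriv_eq_zero (fun l => (hd l).differentiableAt) (fun l => (hd l).deriv)
    l 0
  rw [hc]
  simp only [Complex.ofReal_zero, mul_zero, add_zero, Complex.one_cpow, one_mul]
  have e : ∀ s : ℝ, besselLaplaceKernel ν 0 s =
      ((Real.exp (-s) * s ^ (2 * ν + 1 - 1) * (Real.Gamma (ν + 1))⁻¹ : ℝ) : ℂ) := by
    intro s
    have : besselSeries ν 0 = (Real.Gamma (ν + 1))⁻¹ := by
      unfold besselSeries
      rw [tsum_eq_single 0 (fun k hk => by simp [hk])]
      simp
    unfold besselLaplaceKernel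
    rw [show ((0 : ℝ) * s) ^ 2 / 4 = 0 by ring, this, add_sub_cancel_right,
      show -(1 + Complex.I * ((0 : ℝ) : ℂ)) * s = ((-s : ℝ) : ℂ) by push_cast; ring]
    push_cast
    ring
  rw [besselLaplace]
  simp only [e]
  rw [integral_complex_ofReal, integral_mul_const, ← Real.Gamma_eq_integral (by linarith)]
  push_cast
  ring

lemma tendsto_integral_Ioi_mul_cexp_atTop (g : ℝ → ℝ) :
    Tendsto (fun l : ℝ => ∫ s in Ioi (0 : ℝ), (g s : ℂ) * Complex.exp (-(2 * Complex.I * l * s)))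
      atTop (𝓝 0) := by
  have h1 := (Real.tendsto_integral_exp_smul_cocompact
    (indicator (Ioi (0 : ℝ)) fun s => (g s : ℂ))).mono_left atTop_le_cocompact
  have h2 : Tendsto (fun l : ℝ => l / Real.pi) atTop atTop :=
    tendsto_id.atTop_div_const Real.pi_pos
  refine (h1.comp h2).congr fun l => ?_
  rw [← integral_indicator measurableSet_Ioi]
  refine integral_congr_ae (Eventually.of_forall fun s => ?_)
  simp only [indicator]
  split_ifs with hs
  · rw [Circle.smul_def, Real.fourierChar_apply, smul_eq_mul, mul_comm]
    congr 2
    have := Real.pi_ne_zero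
    push_cast
    field_simp
  · simp

lemma one_add_two_I_mul_cpow {l : ℝ} (hl : 0 < l) (a : ℝ) :
    (1 + 2 * Complex.I * l) ^ (a : ℂ) = ((l ^ a : ℝ) : ℂ) * (((l⁻¹ : ℝ) : ℂ) + 2 * Complex.I) ^ (a : ℂ) := by
  have h0 : ((l⁻¹ : ℝ) : ℂ) + 2 * Complex.I ≠ 0 := by
    intro h
    have := congrArg Complex.im h
    simp at this
  have h1 : (1 + 2 * Complex.I * l) = (l : ℂ) * (((l⁻¹ : ℝ) : ℂ) + 2 * Complex.I) := by
    have : (l : ℂ) ≠ 0 := by exact_mod_cast hl.ne'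
    push_cast
    field_simp
  have h2 : (l : ℂ) ≠ 0 := by exact_mod_cast hl.ne'
  rw [h1, Complex.ofReal_cpow hl.le, Complex.cpow_def_of_ne_zero (mul_ne_zero h2 h0),
    Complex.cpow_def_of_ne_zero h2, Complex.cpow_def_of_ne_zero h0, Complex.log_ofReal_mul hl h0,
    Complex.ofReal_log hl.le, add_mul, Complex.exp_add]

lemma exists_sqrt_mul_besselJ_bound {ν : ℝ} (hν : 1 ≤ ν) {c : ℂ} {K : ℝ}
    (h : ∀ t, 1 ≤ t → |√t * besselJ ν t - (c * Complex.exp (t * Complex.I)).re| ≤ K / t) :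
    ∃ K', ∀ t, 0 < t → |√t * besselJ ν t - (c * Complex.exp (t * Complex.I)).re| ≤ K' := by
  obtain ⟨K₀, hK₀, h₀⟩ := exists_abs_besselSeries_sq_le (by linarith : 0 ≤ ν)
  refine ⟨max K (K₀ + ‖c‖), fun t ht => ?_⟩
  rcases le_total 1 t with h1 | h1
  · refine le_max_of_le_left ((h t h1).trans ?_)
    have := (abs_nonneg _).trans (h 1 le_rfl)
    exact div_le_self (by simpa using this) h1
  · refine le_max_of_le_right ((abs_sub _ _).trans (add_le_add ?_ ?_))
    · rw [besselJ_eq, abs_mul, abs_mul, abs_of_nonneg (Real.sqrt_nonneg t),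
        abs_of_nonneg (by positivity)]
      have e1 : √t ≤ 1 := by simpa using Real.sqrt_le_sqrt h1
      have e2 : (t / 2) ^ ν ≤ 1 := Real.rpow_le_one (by positivity) (by linarith) (by linarith)
      calc √t * ((t / 2) ^ ν * |besselSeries ν (t ^ 2 / 4)|) ≤ 1 * (1 * K₀) := by
            gcongr; exact h₀ t
        _ = K₀ := by ring
    · refine (Complex.abs_re_le_norm _).trans ?_
      rw [norm_mul, Complex.norm_exp_ofReal_mul_I, mul_one]

lemma tendsto_rpow_mul_besselLaplace {ν : ℝ} (hν : 1 ≤ ν) {c : ℂ} {K : ℝ}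
    (h : ∀ t, 1 ≤ t → |√t * besselJ ν t - (c * Complex.exp (t * Complex.I)).re| ≤ K / t) :
    Tendsto (fun l : ℝ => ((l ^ (ν + 1 / 2) : ℝ) : ℂ) * besselLaplace ν l) atTop
      (𝓝 (((2 ^ ν : ℝ) : ℂ) * (c / 2 * Real.Gamma (ν + 1 / 2)))) := by
  obtain ⟨K', hK'⟩ := exists_sqrt_mul_besselJ_bound hν h
  set r : ℝ → ℝ := fun t => √t * besselJ ν t - (c * Complex.exp (t * Complex.I)).re with hr
  have hrc : ContinuousOn r (Ioi 0) := by
    have : ContinuousOn (besselJ ν) (Ioi 0) := fun t ht =>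
      (hasDerivAt_besselJ ν ht).continuousAt.continuousWithinAt
    have h2 : Continuous fun t : ℝ => (c * Complex.exp (t * Complex.I)).re := by fun_prop
    exact (Real.continuous_sqrt.continuousOn.mul this).sub h2.continuousOn
  set g : ℝ → ℝ := fun s => Real.exp (-s) * s ^ (ν - 1 / 2) with hg
  have hgi : IntegrableOn g (Ioi 0) := integrableOn_exp_neg_mul_rpow (by linarith)
  have hgc : Continuous g :=
    (Real.continuous_exp.comp continuous_neg).mul (Real.continuous_rpow_const (by linarith))
  have hgp : ∀ s, 0 < s → 0 ≤ g s := fun s hs => by positivity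
  have hGamma : ∫ s in Ioi (0 : ℝ), g s = Real.Gamma (ν + 1 / 2) := by
    rw [Real.Gamma_eq_integral (by linarith)]
    refine setIntegral_congr_fun measurableSet_Ioi fun s _ => ?_
    simp only [hg]
    congr 2; ring
  have dec : ∀ l : ℝ, 0 < l → ∀ s ∈ Ioi (0 : ℝ),
      ((l ^ (ν + 1 / 2) : ℝ) : ℂ) * besselLaplaceKernel ν l s =
      ((2 ^ ν : ℝ) : ℂ) * (c / 2 * g s + (starRingEnd ℂ c / 2 *
        ((g s : ℂ) * Complex.exp (-(2 * Complex.I * l * s))) +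
        (g s : ℂ) * (Complex.exp (-(Complex.I * l * s)) * r (l * s)))) := by
    intro l hl s hs
    have hs : 0 < s := hs
    have e1 : l ^ (ν + 1 / 2) * s ^ (2 * ν) =
        2 ^ ν * (s ^ (ν - 1 / 2) * (√(l * s) * (l * s / 2) ^ ν)) := by
      rw [Real.sqrt_eq_rpow, Real.div_rpow (by positivity) (by norm_num),
        Real.mul_rpow hl.le hs.le, Real.mul_rpow hl.le hs.le, Real.rpow_add hl,
        show 2 * ν = (ν - 1 / 2) + (1 / 2 + ν) by ring, Real.rpow_add hs, Real.rpow_add hs]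
      field_simp
    have e2 : Complex.exp (-(1 + Complex.I * l) * s) =
        (Real.exp (-s) : ℂ) * Complex.exp (-(Complex.I * l * s)) := by
      rw [Complex.ofReal_exp, ← Complex.exp_add]; congr 1; push_cast; ring
    have e3 : Complex.exp (-(2 * Complex.I * l * s)) =
        Complex.exp (-(Complex.I * l * s)) * Complex.exp (-(Complex.I * l * s)) := by
      rw [← Complex.exp_add]; congr 1; ring
    have e4 : Complex.exp ((l * s : ℝ) * Complex.I) * Complex.exp (-(Complex.I * l * s)) = 1 := by
      rw [← Complex.exp_add, Complex.exp_eq_one_iff]; exact ⟨0, by push_cast; ring⟩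
    have e5 : ((c * Complex.exp ((l * s : ℝ) * Complex.I)).re : ℂ) =
        (c * Complex.exp ((l * s : ℝ) * Complex.I) +
          starRingEnd ℂ c * Complex.exp (-(Complex.I * l * s))) / 2 := by
      rw [Complex.re_eq_add_conj, map_mul, ← Complex.exp_conj]
      congr 4
      simp; ring
    have e6 := congrArg (fun r : ℝ => (r : ℂ)) e1
    simp only [hr, hg, besselLaplaceKernel]
    rw [besselJ_eq, e2, e3, Complex.ofReal_sub, e5]
    push_cast at e6 ⊢
    push_cast at e4
    linear_combination (Complex.exp (-s) * Complex.exp (-(Complex.I * l * s)) *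
      besselSeries ν ((l * s) ^ 2 / 4)) * e6 +
      (((2 ^ ν : ℝ) : ℂ) * (Complex.exp (-s) * ((s ^ (ν - 1 / 2) : ℝ) : ℂ)) * c / 2) * e4
  have i1 : IntegrableOn (fun s => c / 2 * (g s : ℂ)) (Ioi 0) := hgi.ofReal.const_mul _
  have i2 : ∀ l : ℝ, IntegrableOn (fun s : ℝ => starRingEnd ℂ c / 2 *
        ((g s : ℂ) * Complex.exp (-(2 * Complex.I * l * s)))) (Ioi 0) := by
    intro l
    refine Integrable.const_mul (Integrable.mono' hgi (by
      have : Continuous fun s : ℝ => (g s : ℂ) * Complex.exp (-(2 * Complex.I * l * s)) := by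
        fun_prop
      exact this.aestronglyMeasurable) ?_) _
    filter_upwards [ae_restrict_mem measurableSet_Ioi] with s hs
    rw [norm_mul, Complex.norm_real, Real.norm_of_nonneg (hgp s hs), Complex.norm_exp]
    simp
  have m3 : ∀ l : ℝ, 0 < l → AEStronglyMeasurable (fun s : ℝ => (g s : ℂ) *
      (Complex.exp (-(Complex.I * l * s)) * r (l * s))) (volume.restrict (Ioi 0)) := by
    intro l hl
    refine ContinuousOn.aestronglyMeasurable ?_ measurableSet_Ioi
    have h1 : ContinuousOn (fun s => r (l * s)) (Ioi 0) :=
      hrc.comp (continuous_const.mul continuous_id).continuousOn fun s hs => mul_pos hl hs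
    have h2 : ContinuousOn (fun s => ((r (l * s) : ℝ) : ℂ)) (Ioi 0) :=
      Complex.continuous_ofReal.comp_continuousOn h1
    have h3 : Continuous fun s : ℝ => (g s : ℂ) := by fun_prop
    have h4 : Continuous fun s : ℝ => Complex.exp (-(Complex.I * l * s)) := by fun_prop
    exact h3.continuousOn.mul (h4.continuousOn.mul h2)
  have b3 : ∀ l : ℝ, 0 < l → ∀ᵐ s ∂(volume.restrict (Ioi (0 : ℝ))), ‖(g s : ℂ) *
      (Complex.exp (-(Complex.I * l * s)) * r (l * s))‖ ≤ g s * K' := by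
    intro l hl
    filter_upwards [ae_restrict_mem measurableSet_Ioi] with s hs
    rw [norm_mul, norm_mul, Complex.norm_real, Complex.norm_real, Real.norm_of_nonneg (hgp s hs),
      show ‖Complex.exp (-(Complex.I * l * s))‖ = 1 by rw [Complex.norm_exp]; simp, one_mul]
    exact mul_le_mul_of_nonneg_left (hK' _ (mul_pos hl hs)) (hgp s hs)
  have i3 : ∀ l : ℝ, 0 < l → IntegrableOn (fun s : ℝ => (g s : ℂ) *
      (Complex.exp (-(Complex.I * l * s)) * r (l * s))) (Ioi 0) := fun l hl =>
    Integrable.mono' (hgi.mul_const K') (m3 l hl) (b3 l hl)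
  have hr0 : Tendsto r atTop (𝓝 0) := by
    refine squeeze_zero_norm' ?_ (tendsto_const_nhds.div_atTop tendsto_id : Tendsto
      (fun t : ℝ => K / t) atTop (𝓝 0))
    filter_upwards [eventually_ge_atTop 1] with t ht using h t ht
  have t3 : Tendsto (fun l : ℝ => ∫ s in Ioi (0 : ℝ), (g s : ℂ) *
      (Complex.exp (-(Complex.I * l * s)) * r (l * s))) atTop (𝓝 0) := by
    have := tendsto_integral_filter_of_dominated_convergence (l := (atTop : Filter ℝ))
      (μ := volume.restrict (Ioi (0 : ℝ))) (F := fun (l : ℝ) (s : ℝ) => (g s : ℂ) *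
        (Complex.exp (-(Complex.I * l * s)) * r (l * s))) (f := fun _ => 0) (fun s => g s * K')
      (by filter_upwards [eventually_gt_atTop 0] with l hl using m3 l hl)
      (by filter_upwards [eventually_gt_atTop 0] with l hl using b3 l hl)
      (hgi.mul_const K') (by
        filter_upwards [ae_restrict_mem measurableSet_Ioi] with s hs
        have hs : 0 < s := hs
        have h1 := (hr0.comp (tendsto_id.atTop_mul_const hs)).norm.const_mul (g s)
        rw [norm_zero, mul_zero] at h1
        refine squeeze_zero_norm (fun l => le_of_eq ?_) h1
        rw [norm_mul, norm_mul, Complex.norm_real, Complex.norm_real,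
          Real.norm_of_nonneg (hgp s hs),
          show ‖Complex.exp (-(Complex.I * l * s))‖ = 1 by rw [Complex.norm_exp]; simp, one_mul]
        rfl)
    simpa using this
  have t2 := (tendsto_integral_Ioi_mul_cexp_atTop g).const_mul (starRingEnd ℂ c / 2)
  have key := (((tendsto_const_nhds (x := c / 2 * (Real.Gamma (ν + 1 / 2) : ℂ))).add
    (t2.add t3))).const_mul ((2 ^ ν : ℝ) : ℂ)
  rw [mul_zero, add_zero, add_zero] at key
  refine key.congr' ?_
  filter_upwards [eventually_gt_atTop 0] with l hl
  have e : ((l ^ (ν + 1 / 2) : ℝ) : ℂ) * besselLaplace ν l =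
      ∫ s in Ioi (0 : ℝ), ((l ^ (ν + 1 / 2) : ℝ) : ℂ) * besselLaplaceKernel ν l s :=
    (integral_const_mul _ _).symm
  have i23 : IntegrableOn (fun s : ℝ => starRingEnd ℂ c / 2 *
      ((g s : ℂ) * Complex.exp (-(2 * Complex.I * l * s))) +
      (g s : ℂ) * (Complex.exp (-(Complex.I * l * s)) * r (l * s))) (Ioi 0) :=
    (i2 l).add (i3 l hl)
  rw [e, setIntegral_congr_fun measurableSet_Ioi (dec l hl), integral_const_mul,
    integral_add i1 i23, integral_add (i2 l) (i3 l hl),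
    integral_const_mul, integral_const_mul, integral_complex_ofReal, hGamma]

lemma two_mul_I_cpow (a : ℝ) : (2 * Complex.I) ^ (a : ℂ) =
    ((2 ^ a : ℝ) : ℂ) * Complex.exp ((a * (π / 2) : ℝ) * Complex.I) := by
  have h2 : (2 : ℂ) = ((2 : ℝ) : ℂ) := by norm_num
  rw [Complex.cpow_def_of_ne_zero (by simp), h2,
    Complex.log_ofReal_mul (by norm_num) Complex.I_ne_zero, Complex.log_I,
    Real.rpow_def_of_pos (by norm_num), Complex.ofReal_exp, ← Complex.exp_add]
  congr 1; push_cast; ring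

lemma besselJ_amplitude_eq {ν : ℝ} (hν : 1 ≤ ν) {c : ℂ} {K : ℝ}
    (h : ∀ t, 1 ≤ t → |√t * besselJ ν t - (c * Complex.exp (t * Complex.I)).re| ≤ K / t) :
    c = (√(2 / π) : ℂ) * Complex.exp ((-(ν * π / 2 + π / 4) : ℝ) * Complex.I) := by
  have h1 := tendsto_rpow_mul_besselLaplace hν h
  have h2 : Tendsto (fun l : ℝ => (((l⁻¹ : ℝ) : ℂ) + 2 * Complex.I) ^ ((ν + 1 / 2 : ℝ) : ℂ)) atTop
      (𝓝 ((2 * Complex.I) ^ ((ν + 1 / 2 : ℝ) : ℂ))) := by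
    have h3 : Tendsto (fun l : ℝ => ((l⁻¹ : ℝ) : ℂ) + 2 * Complex.I) atTop
        (𝓝 (2 * Complex.I)) := by
      have := ((Complex.continuous_ofReal.tendsto 0).comp
        (tendsto_inv_atTop_zero (𝕜 := ℝ))).add_const (2 * Complex.I)
      simpa [Function.comp_def] using this
    exact h3.cpow tendsto_const_nhds (by simp [Complex.mem_slitPlane_iff])
  have h4 : (2 * Complex.I) ^ ((ν + 1 / 2 : ℝ) : ℂ) *
      (((2 ^ ν : ℝ) : ℂ) * (c / 2 * Real.Gamma (ν + 1 / 2))) =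
      Real.Gamma (2 * ν + 1) / Real.Gamma (ν + 1) := by
    refine tendsto_nhds_unique (h2.mul h1) (tendsto_const_nhds.congr' ?_)
    filter_upwards [eventually_gt_atTop 0] with l hl
    rw [← besselLaplace_eq (by linarith : 0 ≤ ν) l, ← mul_assoc, mul_comm (_ ^ _) (((l ^ _ : ℝ)) : ℂ),
      ← one_add_two_I_mul_cpow hl]
    push_cast; rfl
  have hd := Real.Gamma_mul_Gamma_add_half (ν + 1 / 2)
  rw [show ν + 1 / 2 + 1 / 2 = ν + 1 by ring, show 2 * (ν + 1 / 2) = 2 * ν + 1 by ring] at hd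
  have g1 : Real.Gamma (ν + 1 / 2) ≠ 0 := (Real.Gamma_pos_of_pos (by linarith)).ne'
  have g2 : Real.Gamma (ν + 1) ≠ 0 := (Real.Gamma_pos_of_pos (by linarith)).ne'
  have e1 : Real.Gamma (2 * ν + 1) / Real.Gamma (ν + 1) * (2 ^ (ν + 1 / 2) * (2 ^ ν / 2))⁻¹ =
      √(2 / π) * Real.Gamma (ν + 1 / 2) := by
    rw [show (1 - (2 * ν + 1)) = -(2 * ν) by ring, Real.rpow_neg (by norm_num)] at hd
    have hp := Real.sqrt_pos.2 Real.pi_pos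
    have h5 : (2 : ℝ) ^ (2 * ν) = 2 ^ ν * 2 ^ ν := by
      rw [← Real.rpow_add (by norm_num)]; ring_nf
    have h6 : (2 : ℝ) ^ (ν + 1 / 2) = 2 ^ ν * √2 := by
      rw [Real.rpow_add (by norm_num), Real.sqrt_eq_rpow]
    have h7 : 0 < (2 : ℝ) ^ ν := by positivity
    have h8 : √2 * √2 = 2 := Real.mul_self_sqrt (by norm_num)
    rw [h5] at hd
    rw [h6, Real.sqrt_div (by norm_num)]
    generalize Real.Gamma (ν + 1 / 2) = G at hd ⊢
    field_simp at hd ⊢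
    linear_combination (-2) * hd - (2 ^ ν) ^ 2 * Real.Gamma (ν + 1) * G * h8
  have e2 := congrArg (fun r : ℝ => (r : ℂ)) e1
  rw [two_mul_I_cpow] at h4
  have h9 : Complex.exp ((-(ν * π / 2 + π / 4) : ℝ) * Complex.I) *
      Complex.exp (((ν + 1 / 2) * (π / 2) : ℝ) * Complex.I) = 1 := by
    rw [← Complex.exp_add, Complex.exp_eq_one_iff]; exact ⟨0, by push_cast; ring⟩
  have k1 : ((2 ^ ν : ℝ) : ℂ) ≠ 0 := by exact_mod_cast (by positivity : (2 : ℝ) ^ ν ≠ 0)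
  have k2 : ((2 ^ (ν + 1 / 2) : ℝ) : ℂ) ≠ 0 := by
    exact_mod_cast (by positivity : (2 : ℝ) ^ (ν + 1 / 2) ≠ 0)
  have k3 : (Real.Gamma (ν + 1 / 2) : ℂ) ≠ 0 := by exact_mod_cast g1
  have k4 : (Real.Gamma (ν + 1) : ℂ) ≠ 0 := by exact_mod_cast g2
  rw [Complex.ofReal_mul, Complex.ofReal_div, ← h4] at e2
  set E := Complex.exp (((ν + 1 / 2) * (π / 2) : ℝ) * Complex.I)
  set F := Complex.exp ((-(ν * π / 2 + π / 4) : ℝ) * Complex.I)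
  rw [Complex.ofReal_inv, Complex.ofReal_mul, Complex.ofReal_div, Complex.ofReal_mul] at e2
  have e3 : E * c = √(2 / π) := by
    generalize (Real.Gamma (ν + 1 / 2) : ℂ) = G at e2 k3
    field_simp at e2
    have h2 : ((2 : ℝ) : ℂ) = 2 := by norm_num
    rw [h2] at e2
    linear_combination e2 / 2
  linear_combination (-c) * h9 + F * e3

lemma tendsto_sqrt_mul_besselJ_of_one_le {ν : ℝ} (hν : 1 ≤ ν) :
    Tendsto (fun t => √t * besselJ ν t - √(2 / π) * Real.cos (t - ν * π / 2 - π / 4)) atTop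
      (𝓝 0) := by
  obtain ⟨c, K, h⟩ := (isBesselPair_besselJ ν).exists_asymptotic
  have hc := besselJ_amplitude_eq hν h
  refine squeeze_zero_norm' ?_ (tendsto_const_nhds.div_atTop tendsto_id : Tendsto
      (fun t : ℝ => K / t) atTop (𝓝 0))
  filter_upwards [eventually_ge_atTop 1] with t ht
  have e : (c * Complex.exp (t * Complex.I)).re =
      √(2 / π) * Real.cos (t - ν * π / 2 - π / 4) := by
    rw [hc, mul_assoc, ← Complex.exp_add, ← add_mul, ← Complex.ofReal_add, Complex.re_ofReal_mul,
      Complex.exp_ofReal_mul_I_re]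
    congr 2; ring
  simpa [e] using h t ht

lemma tendsto_sqrt_mul_besselJ (ν : ℝ) :
    Tendsto (fun t => √t * besselJ ν t - √(2 / π) * Real.cos (t - ν * π / 2 - π / 4)) atTop
      (𝓝 0) := by
  suffices H : ∀ n : ℕ, ∀ ν : ℝ, 1 - n ≤ ν →
      Tendsto (fun t => √t * besselJ ν t - √(2 / π) * Real.cos (t - ν * π / 2 - π / 4)) atTop
      (𝓝 0) by
    obtain ⟨n, hn⟩ := exists_nat_ge (1 - ν)
    exact H n ν (by linarith)
  intro n
  induction n with
  | zero => intro ν hν; exact tendsto_sqrt_mul_besselJ_of_one_le (by simpa using hν)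
  | succ n ih =>
    intro ν hν
    push_cast at hν
    have h1 := ih (ν + 1) (by linarith)
    have h2 := ih (ν + 2) (by linarith)
    have h3 : Tendsto (fun t : ℝ => 2 * (ν + 1) / t) atTop (𝓝 0) :=
      tendsto_const_nhds.div_atTop tendsto_id
    have h4 : Tendsto (fun t : ℝ => 2 * (ν + 1) / t *
        (√(2 / π) * Real.cos (t - (ν + 1) * π / 2 - π / 4))) atTop (𝓝 0) := by
      refine squeeze_zero_norm' (a := fun t => ‖2 * (ν + 1) / t‖ * √(2 / π)) ?_ ?_
      · filter_upwards with t
        rw [norm_mul, norm_mul, Real.norm_of_nonneg (Real.sqrt_nonneg (2 / π))]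
        gcongr
        exact mul_le_of_le_one_right (Real.sqrt_nonneg _) (Real.abs_cos_le_one _)
      · simpa using h3.norm.mul_const (√(2 / π))
    have h5 := ((h3.mul h1).add h4).sub h2
    simp only [mul_zero, add_zero, sub_zero] at h5
    refine h5.congr' ?_
    filter_upwards [eventually_gt_atTop 0] with t ht
    have hrec := besselJ_recurrence (ν + 1) ht
    rw [add_sub_cancel_right, show ν + 1 + 1 = ν + 2 by ring] at hrec
    have c2 : Real.cos (t - (ν + 2) * π / 2 - π / 4) = -Real.cos (t - ν * π / 2 - π / 4) := by
      rw [← Real.cos_sub_pi]; congr 1; ring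
    rw [c2]
    linear_combination (-√t) * hrec

lemma tendsto_sqrt_mul_besselYQuot {μ : ℝ} (hμ : μ ∈ nonIntegers) :
    Tendsto (fun t => √t * besselYQuot μ t - √(2 / π) * Real.sin (t - μ * π / 2 - π / 4)) atTop
      (𝓝 0) := by
  have hs := sin_mul_pi_ne_zero hμ
  have h := (((tendsto_sqrt_mul_besselJ μ).mul_const (Real.cos (μ * π))).sub
    (tendsto_sqrt_mul_besselJ (-μ))).div_const (Real.sin (μ * π))
  simp only [zero_mul, sub_zero, zero_div] at h
  refine h.congr fun t => ?_
  have e : Real.cos (t - -μ * π / 2 - π / 4) =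
      Real.cos (t - μ * π / 2 - π / 4) * Real.cos (μ * π) -
      Real.sin (t - μ * π / 2 - π / 4) * Real.sin (μ * π) := by
    rw [← Real.cos_add]; congr 1; ring
  rw [e, besselYQuot]
  generalize Real.sin (μ * π) = S at hs ⊢
  rw [div_eq_iff hs, sub_mul _ _ S, ← mul_div_assoc, div_mul_cancel₀ _ hs]
  ring

lemma tendsto_mul_sub_mul_atTop {f g F G : ℝ → ℝ} {A B : ℝ} (hF : ∀ t, |F t| ≤ A)
    (hG : ∀ t, |G t| ≤ B) (hf : Tendsto (fun t => f t - F t) atTop (𝓝 0))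
    (hg : Tendsto (fun t => g t - G t) atTop (𝓝 0)) :
    Tendsto (fun t => f t * g t - F t * G t) atTop (𝓝 0) := by
  have h1 : Tendsto (fun t => (f t - F t) * G t) atTop (𝓝 0) :=
    hf.zero_mul_isBoundedUnder_le (isBoundedUnder_of ⟨B, hG⟩)
  have h2 : Tendsto (fun t => F t * (g t - G t)) atTop (𝓝 0) :=
    (hg.zero_mul_isBoundedUnder_le (isBoundedUnder_of ⟨A, hF⟩)).congr fun t => mul_comm _ _
  have h3 := ((hf.mul hg).add h1).add h2
  simp only [mul_zero, add_zero] at h3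
  exact h3.congr fun t => by ring

lemma abs_sqrt_mul_cos_le (A s : ℝ) : |√A * Real.cos s| ≤ √A := by
  rw [abs_mul, abs_of_nonneg (Real.sqrt_nonneg A)]
  exact mul_le_of_le_one_right (Real.sqrt_nonneg _) (Real.abs_cos_le_one _)

lemma abs_sqrt_mul_sin_le (A s : ℝ) : |√A * Real.sin s| ≤ √A := by
  rw [abs_mul, abs_of_nonneg (Real.sqrt_nonneg A)]
  exact mul_le_of_le_one_right (Real.sqrt_nonneg _) (Real.abs_sin_le_one _)

/-- The generalised Wronskian of two Bessel pairs of possibly different orders. -/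
lemma IsBesselPair.hasDerivAt_cross {η μ : ℝ} {u v p q : ℝ → ℝ} (h : IsBesselPair η u v)
    (h' : IsBesselPair μ p q) {t : ℝ} (ht : 0 < t) :
    HasDerivAt (fun t => t * (v t * p t - u t * q t) + (μ - η) * (u t * p t))
      ((μ ^ 2 - η ^ 2) * (u t * p t / t)) t := by
  have d := ((hasDerivAt_id t).mul (((h.snd t ht).mul (h'.fst t ht)).sub
    ((h.fst t ht).mul (h'.snd t ht)))).add (((h.fst t ht).mul (h'.fst t ht)).const_mul (μ - η))
  refine d.congr_deriv ?_
  simp only [Pi.mul_apply, Pi.sub_apply, id]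
  field_simp
  ring

lemma tendsto_cross_besselJ_besselYQuot (η : ℝ) {μ : ℝ} (hμ : μ ∈ nonIntegers) :
    Tendsto (fun t => t * (besselJ (η + 1) t * besselYQuot μ t -
      besselJ η t * besselYQuot (μ + 1) t) + (μ - η) * (besselJ η t * besselYQuot μ t)) atTop
      (𝓝 (2 / π * Real.cos ((η - μ) * π / 2))) := by
  have u := tendsto_sqrt_mul_besselJ η
  have v := tendsto_sqrt_mul_besselJ (η + 1)
  have p := tendsto_sqrt_mul_besselYQuot hμ
  have q := tendsto_sqrt_mul_besselYQuot (add_one_mem_nonIntegers hμ)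
  have bc := fun a t => abs_sqrt_mul_cos_le (2 / π) (t - a * π / 2 - π / 4)
  have bs := fun a t => abs_sqrt_mul_sin_le (2 / π) (t - a * π / 2 - π / 4)
  have vp := tendsto_mul_sub_mul_atTop (bc (η + 1)) (bs μ) v p
  have uq := tendsto_mul_sub_mul_atTop (bc η) (bs (μ + 1)) u q
  have up := tendsto_mul_sub_mul_atTop (bc η) (bs μ) u p
  have up' : Tendsto (fun t => (√t * besselJ η t * (√t * besselYQuot μ t)) * t⁻¹) atTop (𝓝 0) := by
    have h1 : Tendsto (fun t : ℝ => (√(2 / π) * Real.cos (t - η * π / 2 - π / 4)) *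
        (√(2 / π) * Real.sin (t - μ * π / 2 - π / 4)) * t⁻¹) atTop (𝓝 0) := by
      refine Tendsto.congr (fun t => mul_comm _ _) (Tendsto.zero_mul_isBoundedUnder_le
        tendsto_inv_atTop_zero (isBoundedUnder_of ⟨√(2 / π) * √(2 / π), fun t => ?_⟩))
      simp only [Function.comp]
      rw [norm_mul]
      exact mul_le_mul (bc η t) (bs μ t) (norm_nonneg _) (Real.sqrt_nonneg _)
    have h2 := (up.mul tendsto_inv_atTop_zero).add h1
    simp only [mul_zero, add_zero] at h2
    exact h2.congr fun t => by ring
  have key := ((vp.sub uq).add (up'.const_mul (μ - η))).add_const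
    (2 / π * Real.cos ((η - μ) * π / 2))
  simp only [mul_zero, sub_zero, add_zero, zero_add] at key
  refine key.congr' ?_
  filter_upwards [eventually_gt_atTop 0] with t ht
  have e1 : Real.cos (t - (η + 1) * π / 2 - π / 4) = Real.sin (t - η * π / 2 - π / 4) := by
    rw [← Real.cos_sub_pi_div_two]; congr 1; ring
  have e2 : Real.sin (t - (μ + 1) * π / 2 - π / 4) = -Real.cos (t - μ * π / 2 - π / 4) := by
    rw [← Real.sin_sub_pi_div_two]; congr 1; ring
  have e3 : Real.cos ((η - μ) * π / 2) =
      Real.cos (t - μ * π / 2 - π / 4) * Real.cos (t - η * π / 2 - π / 4) +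
      Real.sin (t - μ * π / 2 - π / 4) * Real.sin (t - η * π / 2 - π / 4) := by
    rw [← Real.cos_sub]; congr 1; ring
  have e4 : √(2 / π) * √(2 / π) = 2 / π := Real.mul_self_sqrt (by positivity)
  have e5 : √t * √t = t := Real.mul_self_sqrt ht.le
  have e6 : t * t⁻¹ = 1 := mul_inv_cancel₀ ht.ne'
  rw [e1, e2, e3]
  set c₁ := Real.cos (t - μ * π / 2 - π / 4)
  set c₂ := Real.cos (t - η * π / 2 - π / 4)
  set s₁ := Real.sin (t - μ * π / 2 - π / 4)
  set s₂ := Real.sin (t - η * π / 2 - π / 4)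
  linear_combination (besselJ (η + 1) t * besselYQuot μ t -
    besselJ η t * besselYQuot (μ + 1) t + (μ - η) * (besselJ η t * besselYQuot μ t) * t⁻¹) * e5 +
    (μ - η) * (besselJ η t * besselYQuot μ t) * e6 -
    (c₁ * c₂ + s₁ * s₂) * e4

lemma IsBesselPair.continuousOn {η : ℝ} {u v : ℝ → ℝ} (h : IsBesselPair η u v) :
    ContinuousOn u (Ioi 0) := fun t ht => (h.fst t ht).continuousAt.continuousWithinAt

lemma IsBesselPair.aestronglyMeasurable_mul_div {η μ x : ℝ} {u v p q : ℝ → ℝ}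
    (h : IsBesselPair η u v) (h' : IsBesselPair μ p q) (hx : 0 < x) :
    AEStronglyMeasurable (fun t => u t * p t / t) (volume.restrict (Ioi x)) := by
  refine ContinuousOn.aestronglyMeasurable ?_ measurableSet_Ioi
  have hsub : Ioi x ⊆ Ioi 0 := Ioi_subset_Ioi hx.le
  exact ((h.continuousOn.mono hsub).mul (h'.continuousOn.mono hsub)).div continuousOn_id
    fun t ht => (hx.trans ht).ne'

lemma abs_mul_div_le_of_energy_le {a b c d D E t : ℝ} (ht : 0 < t)
    (h : t * (a ^ 2 + b ^ 2) ≤ D) (h' : t * (c ^ 2 + d ^ 2) ≤ E) :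
    |a * c / t| ≤ (D + E) / 2 * t ^ (-2 : ℝ) := by
  have h1 : t ^ (-2 : ℝ) = (t ^ 2)⁻¹ := by
    rw [Real.rpow_neg ht.le]; norm_num
  have h2 : |a * c| * t ≤ (D + E) / 2 := by
    have : |a * c| ≤ (a ^ 2 + c ^ 2) / 2 := by
      rw [abs_mul]; nlinarith [sq_nonneg (|a| - |c|), sq_abs a, sq_abs c]
    nlinarith [mul_le_mul_of_nonneg_right this ht.le, mul_nonneg ht.le (sq_nonneg b),
      mul_nonneg ht.le (sq_nonneg d)]
  rw [h1, abs_div, abs_of_pos ht]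
  calc |a * c| / t = |a * c| * t * (t ^ 2)⁻¹ := by field_simp
    _ ≤ _ := by gcongr

lemma IsBesselPair.integrableOn_mul_div {η μ x : ℝ} {u v p q : ℝ → ℝ}
    (h : IsBesselPair η u v) (h' : IsBesselPair μ p q) (hx : 0 < x) :
    IntegrableOn (fun t => u t * p t / t) (Ioi x) := by
  obtain ⟨C, -, hC⟩ := exists_energy_le (max |2 * η + 1| |2 * μ + 1|) hx
  refine Integrable.mono' ((integrableOn_Ioi_rpow_of_lt (by norm_num : (-2 : ℝ) < -1) hx).const_mul
    ((C * (u x ^ 2 + v x ^ 2) + C * (p x ^ 2 + q x ^ 2)) / 2))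
    (h.aestronglyMeasurable_mul_div h' hx) ?_
  filter_upwards [ae_restrict_mem measurableSet_Ioi] with t ht
  exact abs_mul_div_le_of_energy_le (hx.trans ht) (hC η u v (le_max_left _ _) h t (le_of_lt ht))
    (hC μ p q (le_max_right _ _) h' t (le_of_lt ht))

lemma tendsto_integral_besselPair_mul_div {l : Filter ℝ} [l.IsCountablyGenerated] {x : ℝ}
    (hx : 0 < x) {a b : ℝ → ℝ} {a₀ b₀ : ℝ} {u v p q : ℝ → ℝ → ℝ} {u₀ v₀ p₀ q₀ : ℝ → ℝ}
    (ha : Tendsto a l (𝓝 a₀)) (hb : Tendsto b l (𝓝 b₀))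
    (h : ∀ᶠ i in l, IsBesselPair (a i) (u i) (v i))
    (h' : ∀ᶠ i in l, IsBesselPair (b i) (p i) (q i))
    (hu : ∀ t, 0 < t → Tendsto (fun i => u i t) l (𝓝 (u₀ t)))
    (hv : ∀ t, 0 < t → Tendsto (fun i => v i t) l (𝓝 (v₀ t)))
    (hp : ∀ t, 0 < t → Tendsto (fun i => p i t) l (𝓝 (p₀ t)))
    (hq : ∀ t, 0 < t → Tendsto (fun i => q i t) l (𝓝 (q₀ t))) :
    Tendsto (fun i => ∫ t in Ioi x, u i t * p i t / t) l
      (𝓝 (∫ t in Ioi x, u₀ t * p₀ t / t)) := by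
  obtain ⟨C, -, hC⟩ := exists_energy_le (max |2 * a₀ + 1| |2 * b₀ + 1| + 1) hx
  have ea : ∀ᶠ i in l, |2 * a i + 1| ≤ max |2 * a₀ + 1| |2 * b₀ + 1| + 1 := by
    filter_upwards [((ha.const_mul 2).add_const 1).abs.eventually_le_const
      (lt_add_one |2 * a₀ + 1|)] with i hi
    exact hi.trans (by gcongr; exact le_max_left _ _)
  have eb : ∀ᶠ i in l, |2 * b i + 1| ≤ max |2 * a₀ + 1| |2 * b₀ + 1| + 1 := by
    filter_upwards [((hb.const_mul 2).add_const 1).abs.eventually_le_const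
      (lt_add_one |2 * b₀ + 1|)] with i hi
    exact hi.trans (by gcongr; exact le_max_right _ _)
  have eu := (((((hu x hx).pow 2).add ((hv x hx).pow 2)).const_mul C)).eventually_le_const
    (lt_add_one _)
  have ep := (((((hp x hx).pow 2).add ((hq x hx).pow 2)).const_mul C)).eventually_le_const
    (lt_add_one _)
  refine tendsto_integral_filter_of_dominated_convergence _ ?_ ?_
    ((integrableOn_Ioi_rpow_of_lt (by norm_num : (-2 : ℝ) < -1) hx).const_mul
    (((C * (u₀ x ^ 2 + v₀ x ^ 2) + 1) + (C * (p₀ x ^ 2 + q₀ x ^ 2) + 1)) / 2)) ?_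
  · filter_upwards [h, h'] with i hi hi' using hi.aestronglyMeasurable_mul_div hi' hx
  · filter_upwards [h, h', ea, eb, eu, ep] with i hi hi' hai hbi hui hpi
    filter_upwards [ae_restrict_mem measurableSet_Ioi] with t ht
    exact abs_mul_div_le_of_energy_le (hx.trans ht)
      ((hC _ _ _ hai hi t (le_of_lt ht)).trans hui) ((hC _ _ _ hbi hi' t (le_of_lt ht)).trans hpi)
  · filter_upwards [ae_restrict_mem measurableSet_Ioi] with t ht
    have ht : 0 < t := hx.trans ht
    exact ((hu t ht).mul (hp t ht)).div_const t

lemma integral_besselJ_mul_besselYQuot (η : ℝ) {μ x : ℝ} (hμ : μ ∈ nonIntegers) (hx : 0 < x) :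
    (μ ^ 2 - η ^ 2) * ∫ t in Ioi x, besselJ η t * besselYQuot μ t / t =
      2 / π * Real.cos ((η - μ) * π / 2) - (x * (besselJ (η + 1) x * besselYQuot μ x -
      besselJ η x * besselYQuot (μ + 1) x) + (μ - η) * (besselJ η x * besselYQuot μ x)) := by
  have h := isBesselPair_besselJ η
  have h' := isBesselPair_besselYQuot hμ
  rw [← integral_const_mul]
  exact integral_Ioi_of_hasDerivAt_of_tendsto' (fun t ht =>
    h.hasDerivAt_cross h' (hx.trans_le ht)) ((h.integrableOn_mul_div h' hx).const_mul _)
    (tendsto_cross_besselJ_besselYQuot η hμ)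

lemma tendsto_besselYQuot_add_one (ν : ℝ) {x : ℝ} (hx : 0 < x) :
    Tendsto (fun μ => besselYQuot (μ + 1) x) (𝓝[nonIntegers] ν) (𝓝 (besselY (ν + 1) x)) :=
  (tendsto_besselYQuot (ν + 1) hx).comp (tendsto_add_one_nonIntegers ν)

lemma continuous_besselJ_order {x : ℝ} (hx : 0 < x) : Continuous fun ν => besselJ ν x :=
  (contDiff_besselJ hx).continuous

lemma tendsto_besselJ_order (ν : ℝ) {x : ℝ} (hx : 0 < x) :
    Tendsto (fun μ => besselJ μ x) (𝓝 ν) (𝓝 (besselJ ν x)) :=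
  (continuous_besselJ_order hx).tendsto ν

lemma tendsto_besselJ_order_add_one (ν : ℝ) {x : ℝ} (hx : 0 < x) :
    Tendsto (fun μ => besselJ (μ + 1) x) (𝓝 ν) (𝓝 (besselJ (ν + 1) x)) :=
  ((continuous_besselJ_order hx).comp (continuous_add_const 1)).tendsto ν

/-- The derivative of `besselJ` with respect to its order. -/
noncomputable def besselJOrderDeriv (ν x : ℝ) : ℝ := deriv (fun μ => besselJ μ x) ν

lemma hasDerivAt_besselJ_order (ν : ℝ) {x : ℝ} (hx : 0 < x) :
    HasDerivAt (fun μ => besselJ μ x) (besselJOrderDeriv ν x) ν :=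
  (differentiableAt_besselJ_order hx ν).hasDerivAt

lemma hasDerivAt_besselJ_order_add_one (ν : ℝ) {x : ℝ} (hx : 0 < x) :
    HasDerivAt (fun μ => besselJ (μ + 1) x) (besselJOrderDeriv (ν + 1) x) ν :=
  (hasDerivAt_besselJ_order (ν + 1) hx).comp_add_const ν 1

lemma continuous_besselJOrderDeriv {x : ℝ} (hx : 0 < x) :
    Continuous fun ν => besselJOrderDeriv ν x :=
  (contDiff_besselJ hx).continuous_deriv le_rfl

/-- The Wronskian of the Bessel functions of the first and second kind. -/
lemma besselJ_besselY_wronskian (ν : ℝ) {x : ℝ} (hx : 0 < x) :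
    x * (besselJ (ν + 1) x * besselY ν x - besselJ ν x * besselY (ν + 1) x) = 2 / π := by
  have := nhdsWithin_nonIntegers_neBot ν
  have h := ((((tendsto_besselJ_order_add_one ν hx).mono_left nhdsWithin_le_nhds).mul
    (tendsto_besselYQuot ν hx)).sub (((tendsto_besselJ_order ν hx).mono_left
    nhdsWithin_le_nhds).mul (tendsto_besselYQuot_add_one ν hx))).const_mul x
  refine tendsto_nhds_unique h (tendsto_const_nhds.congr' ?_)
  filter_upwards [self_mem_nhdsWithin] with μ hμ
  have := integral_besselJ_mul_besselYQuot μ hμ hx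
  simp only [sub_self, zero_mul, zero_div, Real.cos_zero, mul_one, add_zero] at this
  linarith

lemma two_mul_integral_besselJ_mul_besselYQuot {μ x : ℝ} (hμ : μ ∈ nonIntegers) (hx : 0 < x) :
    2 * μ * ∫ t in Ioi x, besselJ μ t * besselYQuot μ t / t =
      -(besselJ μ x * besselYQuot μ x) + x * (besselJOrderDeriv (μ + 1) x * besselYQuot μ x -
        besselJOrderDeriv μ x * besselYQuot (μ + 1) x) := by
  set p := besselYQuot μ x
  set q := besselYQuot (μ + 1) x
  have hd : HasDerivAt (fun η => 2 / π * Real.cos ((η - μ) * π / 2) -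
      (x * (besselJ (η + 1) x * p - besselJ η x * q) + (μ - η) * (besselJ η x * p)))
      (-(x * (besselJOrderDeriv (μ + 1) x * p - besselJOrderDeriv μ x * q) - besselJ μ x * p))
      μ := by
    have h0 := hasDerivAt_besselJ_order μ hx
    have h1 := hasDerivAt_besselJ_order_add_one μ hx
    have hc := ((((hasDerivAt_id μ).sub_const μ).mul_const π).div_const 2).cos.const_mul (2 / π)
    have := hc.sub ((((h1.mul_const p).sub (h0.mul_const q)).const_mul x).add
      (((hasDerivAt_id μ).const_sub μ).mul (h0.mul_const p)))
    refine this.congr_deriv ?_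
    simp
    ring
  have hG : Tendsto (fun η => ∫ t in Ioi x, besselJ η t * besselYQuot μ t / t) (𝓝 μ)
      (𝓝 (∫ t in Ioi x, besselJ μ t * besselYQuot μ t / t)) :=
    tendsto_integral_besselPair_mul_div (b := fun _ => μ) (p := fun _ => besselYQuot μ)
      (q := fun _ => besselYQuot (μ + 1)) hx tendsto_id
      tendsto_const_nhds (Eventually.of_forall fun η => isBesselPair_besselJ η)
      (Eventually.of_forall fun η => isBesselPair_besselYQuot hμ)
      (fun t ht => tendsto_besselJ_order μ ht) (fun t ht => tendsto_besselJ_order_add_one μ ht)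
      (fun t _ => tendsto_const_nhds) (fun t _ => tendsto_const_nhds)
  have h1 := hasDerivAt_iff_tendsto_slope.1 hd
  have h2 := (((tendsto_id.const_add μ).neg).mul hG).mono_left (nhdsWithin_le_nhds (s := {μ}ᶜ))
  have h3 := tendsto_nhds_unique h1 (h2.congr' ?_)
  · linear_combination h3
  filter_upwards [self_mem_nhdsWithin] with η hη
  have hne : η - μ ≠ 0 := sub_ne_zero.2 hη
  have e1 := integral_besselJ_mul_besselYQuot η hμ hx
  have e2 := integral_besselJ_mul_besselYQuot μ hμ hx
  rw [slope_def_field, ← e1, ← e2]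
  field_simp
  simp only [id]
  ring

lemma two_mul_integral_besselJ_mul_besselY (ν : ℝ) {x : ℝ} (hx : 0 < x) :
    2 * ν * ∫ t in Ioi x, besselJ ν t * besselY ν t / t =
      -(besselJ ν x * besselY ν x) + x * (besselJOrderDeriv (ν + 1) x * besselY ν x -
        besselJOrderDeriv ν x * besselY (ν + 1) x) := by
  have := nhdsWithin_nonIntegers_neBot ν
  have hle : 𝓝[nonIntegers] ν ≤ 𝓝 ν := nhdsWithin_le_nhds
  have hid : Tendsto (fun μ : ℝ => μ) (𝓝[nonIntegers] ν) (𝓝 ν) := hle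
  have hG : Tendsto (fun μ => ∫ t in Ioi x, besselJ μ t * besselYQuot μ t / t)
      (𝓝[nonIntegers] ν) (𝓝 (∫ t in Ioi x, besselJ ν t * besselY ν t / t)) :=
    tendsto_integral_besselPair_mul_div hx hid hid
      (Eventually.of_forall fun η => isBesselPair_besselJ η)
      (by filter_upwards [self_mem_nhdsWithin] with μ hμ using isBesselPair_besselYQuot hμ)
      (fun t ht => (tendsto_besselJ_order ν ht).mono_left hle)
      (fun t ht => (tendsto_besselJ_order_add_one ν ht).mono_left hle)
      (fun t ht => tendsto_besselYQuot ν ht) (fun t ht => tendsto_besselYQuot_add_one ν ht)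
  have c0 := ((continuous_besselJOrderDeriv hx).tendsto ν).mono_left hle
  have c1 := (((continuous_besselJOrderDeriv hx).comp (continuous_add_const 1)).tendsto
    ν).mono_left hle
  have p := tendsto_besselYQuot ν hx
  have q := tendsto_besselYQuot_add_one ν hx
  have hR := ((((tendsto_besselJ_order ν hx).mono_left hle).mul p).neg).add
    (((c1.mul p).sub (c0.mul q)).const_mul x)
  refine tendsto_nhds_unique ((hid.const_mul 2).mul hG) (hR.congr' ?_)
  filter_upwards [self_mem_nhdsWithin] with μ hμ
  exact (two_mul_integral_besselJ_mul_besselYQuot hμ hx).symm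

lemma besselY_recurrence (ν : ℝ) {x : ℝ} (hx : 0 < x) :
    besselY (ν + 1 + 1) x = 2 * (ν + 1) / x * besselY (ν + 1) x - besselY ν x := by
  have := nhdsWithin_nonIntegers_neBot ν
  have hid : Tendsto (fun μ : ℝ => μ) (𝓝[nonIntegers] ν) (𝓝 ν) := nhdsWithin_le_nhds
  have h1 := (tendsto_besselYQuot_add_one (ν + 1) hx).comp (tendsto_add_one_nonIntegers ν)
  have h2 := (((((hid.add_const 1).const_mul 2).div_const x).mul
    (tendsto_besselYQuot_add_one ν hx)).sub (tendsto_besselYQuot ν hx))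
  refine tendsto_nhds_unique h1 (h2.congr' ?_)
  filter_upwards [self_mem_nhdsWithin] with μ hμ
  have := ((isBesselPair_besselYQuot hμ).snd x hx).unique
    ((isBesselPair_besselYQuot (add_one_mem_nonIntegers hμ)).fst x hx)
  simp only [Function.comp]
  linear_combination -this

lemma besselJOrderDeriv_recurrence (ν : ℝ) {x : ℝ} (hx : 0 < x) :
    besselJOrderDeriv (ν + 1 + 1) x = 2 / x * besselJ (ν + 1) x +
      2 * (ν + 1) / x * besselJOrderDeriv (ν + 1) x - besselJOrderDeriv ν x := by
  have h2 := (hasDerivAt_besselJ_order_add_one (ν + 1) hx).comp_add_const ν 1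
  have h1 := hasDerivAt_besselJ_order_add_one ν hx
  have h0 := hasDerivAt_besselJ_order ν hx
  have h := (((((hasDerivAt_id ν).add_const 1).const_mul 2).div_const x).mul h1).sub h0
  refine (h2.unique (h.congr_of_eventuallyEq (Eventually.of_forall fun μ => ?_))).trans ?_
  · have := besselJ_recurrence (μ + 1) hx
    rw [add_sub_cancel_right] at this
    simp only [Pi.sub_apply, Pi.mul_apply, id]
    linear_combination this
  · simp only [id]
    ring

lemma besselJ_besselY_integral_succ (ν : ℝ) {x : ℝ} (hx : 0 < x) :
    2 * (ν + 1) * (∫ t in Ioi x, besselJ (ν + 1) t * besselY (ν + 1) t / t) -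
      2 * ν * ∫ t in Ioi x, besselJ ν t * besselY ν t / t =
      besselJ ν x * besselY ν x + besselJ (ν + 1) x * besselY (ν + 1) x := by
  rw [two_mul_integral_besselJ_mul_besselY _ hx, two_mul_integral_besselJ_mul_besselY _ hx,
    besselY_recurrence ν hx, besselJOrderDeriv_recurrence ν hx]
  field_simp
  ring

lemma norm_Gamma_mul_inv_Gamma_le {z : ℂ} (hz : 0 ≤ z.re) (k : ℕ) :
    ‖Complex.Gamma (z + 1) * (Complex.Gamma (z + (k + 1 : ℕ) + 1))⁻¹‖ ≤ ‖z + 1‖⁻¹ := by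
  have hne : ∀ m : ℕ, z + (m + 1 : ℕ) ≠ 0 := fun m h => by
    have := congrArg Complex.re h
    simp at this
    have hm : (0 : ℝ) ≤ m := m.cast_nonneg
    linarith
  induction k with
  | zero =>
    have hG : Complex.Gamma (z + 1) ≠ 0 := Complex.Gamma_ne_zero_of_re_pos (by simp; linarith)
    have h1 : z + (0 + 1 : ℕ) = z + 1 := by simp
    rw [Complex.Gamma_add_one _ (hne 0), h1, mul_inv, mul_comm, mul_assoc, inv_mul_cancel₀ hG,
      mul_one, norm_inv]
  | succ k ih =>
    have h1 : z + (k + 1 + 1 : ℕ) = z + (k + 1 : ℕ) + 1 := by push_cast; ring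
    rw [Complex.Gamma_add_one _ (hne (k + 1)), mul_inv, mul_left_comm, norm_mul, norm_inv]
    have h2 : 1 ≤ ‖z + (k + 1 + 1 : ℕ)‖ := by
      refine le_trans ?_ (Complex.re_le_norm _)
      simp
      have hm : (0 : ℝ) ≤ k := k.cast_nonneg
      linarith
    rw [← h1] at ih
    exact (mul_le_of_le_one_left (norm_nonneg _) (inv_le_one_of_one_le₀ h2)).trans ih

lemma norm_Gamma_mul_besselSeriesC_sub_one_le (y : ℝ) {z : ℂ} (hz : 0 ≤ z.re) :
    ‖Complex.Gamma (z + 1) * besselSeriesC y z - 1‖ ≤ Real.exp |y| * ‖z + 1‖⁻¹ := by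
  have hG : Complex.Gamma (z + 1) ≠ 0 := Complex.Gamma_ne_zero_of_re_pos (by simp; linarith)
  set f : ℕ → ℂ := fun k => Complex.Gamma (z + 1) *
    ((((-y) ^ k / k.factorial : ℝ) : ℂ) * (Complex.Gamma (z + k + 1))⁻¹) with hf
  set g : ℕ → ℂ := fun k => f k - if k = 0 then 1 else 0 with hg
  have hb : ∀ k, ‖g k‖ ≤ |y| ^ k / k.factorial * ‖z + 1‖⁻¹ := by
    intro k
    rcases k with _ | k
    · simp only [hg, hf]
      simp [hG]
    · simp only [hg, hf]
      rw [if_neg (Nat.succ_ne_zero k), sub_zero, mul_left_comm, norm_mul, Complex.norm_real,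
        norm_div, norm_pow, norm_neg, Real.norm_eq_abs, Real.norm_natCast]
      exact mul_le_mul_of_nonneg_left (norm_Gamma_mul_inv_Gamma_le hz k) (by positivity)
  have hs : HasSum (fun k : ℕ => |y| ^ k / k.factorial * ‖z + 1‖⁻¹)
      (Real.exp |y| * ‖z + 1‖⁻¹) := by
    have := NormedSpace.expSeries_div_hasSum_exp (𝔸 := ℝ) |y|
    rw [← Real.exp_eq_exp_ℝ] at this
    exact this.mul_right _
  have hgs : Summable g := Summable.of_norm_bounded hs.summable hb
  have h1 : HasSum f (∑' k, g k + 1) := by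
    have := hgs.hasSum.add (hasSum_ite_eq 0 (1 : ℂ))
    refine this.congr_fun fun k => ?_
    simp [hg]
  have h2 : Complex.Gamma (z + 1) * besselSeriesC y z = ∑' k, g k + 1 := by
    rw [← h1.tsum_eq, besselSeriesC, ← tsum_mul_left]
  rw [h2, add_sub_cancel_right]
  exact tsum_of_norm_bounded hs hb

/-- The Bessel series normalised so as to tend to one at large order. -/
noncomputable def besselNormalized (y ν : ℝ) : ℝ := Real.Gamma (ν + 1) * besselSeries ν y

lemma besselNormalized_eq_re (y ν : ℝ) : besselNormalized y ν =
    (Complex.Gamma (ν + 1) * besselSeriesC y ν).re := by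
  rw [besselSeriesC_ofReal, show (ν : ℂ) + 1 = ((ν + 1 : ℝ) : ℂ) by push_cast; rfl,
    Complex.Gamma_ofReal, ← Complex.ofReal_mul, Complex.ofReal_re, besselNormalized]

lemma abs_besselNormalized_sub_one_le (y : ℝ) {ν : ℝ} (hν : 0 ≤ ν) :
    |besselNormalized y ν - 1| ≤ Real.exp |y| / (ν + 1) := by
  have h := norm_Gamma_mul_besselSeriesC_sub_one_le y (z := ν) (by simpa using hν)
  have e : ‖(ν : ℂ) + 1‖ = ν + 1 := by
    rw [show (ν : ℂ) + 1 = ((ν + 1 : ℝ) : ℂ) by push_cast; rfl, Complex.norm_real,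
      Real.norm_of_nonneg (by linarith)]
  rw [e, ← div_eq_mul_inv] at h
  refine le_trans ?_ h
  rw [besselNormalized_eq_re]
  simpa using Complex.abs_re_le_norm (Complex.Gamma (ν + 1) * besselSeriesC y ν - 1)

lemma exists_hasDerivAt_besselNormalized (y : ℝ) {ν : ℝ} (hν : 1 ≤ ν) :
    ∃ d, HasDerivAt (besselNormalized y) d ν ∧ |d| ≤ Real.exp |y| / ν := by
  set H : ℂ → ℂ := fun z => Complex.Gamma (z + 1) * besselSeriesC y z - 1 with hH
  have hre : ∀ z ∈ Metric.closedBall (ν : ℂ) 1, ν - 1 ≤ z.re := by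
    intro z hz
    have h1 := (Complex.abs_re_le_norm (z - ν)).trans (mem_closedBall_iff_norm.1 hz)
    have h2 := (abs_le.1 h1).1
    simp at h2
    linarith
  have hd : ∀ z : ℂ, 0 ≤ z.re → DifferentiableAt ℂ H z := by
    intro z hz
    have hg : DifferentiableAt ℂ Complex.Gamma (z + 1) :=
      Complex.differentiableAt_Gamma _ fun m h => by
        have := congrArg Complex.re h
        simp at this
        have hm : (0 : ℝ) ≤ m := m.cast_nonneg
        linarith
    exact ((hg.comp z (differentiableAt_id.add_const 1)).mul
      (differentiable_besselSeriesC y z)).sub_const 1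
  have hD : DiffContOnCl ℂ H (Metric.ball (ν : ℂ) 1) := by
    refine DifferentiableOn.diffContOnCl fun z hz => ?_
    rw [closure_ball _ one_ne_zero] at hz
    exact (hd z (by linarith [hre z hz])).differentiableWithinAt
  have hb := Complex.norm_deriv_le_of_forall_mem_sphere_norm_le (C := Real.exp |y| / ν) one_pos hD
    fun z hz => by
      have hz' := hre z (Metric.sphere_subset_closedBall hz)
      refine (norm_Gamma_mul_besselSeriesC_sub_one_le y (by linarith)).trans ?_
      rw [← div_eq_mul_inv]
      have : ν ≤ ‖z + 1‖ := le_trans (by simp; linarith) (Complex.re_le_norm (z + 1))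
      gcongr
  rw [div_one] at hb
  refine ⟨(deriv H ν).re, ?_, (Complex.abs_re_le_norm _).trans hb⟩
  have h1 := ((hd ν (by simp; linarith)).hasDerivAt.real_of_complex).add_const 1
  refine h1.congr_of_eventuallyEq (Eventually.of_forall fun μ => ?_)
  simp only [hH, besselNormalized_eq_re]
  simp

lemma tendsto_besselNormalized (y : ℝ) : Tendsto (besselNormalized y) atTop (𝓝 1) := by
  rw [tendsto_iff_norm_sub_tendsto_zero]
  refine squeeze_zero' (Eventually.of_forall fun _ => norm_nonneg _) ?_
    (tendsto_const_nhds.div_atTop (tendsto_atTop_add_const_right _ 1 tendsto_id) : Tendsto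
      (fun ν : ℝ => Real.exp |y| / (ν + 1)) atTop (𝓝 0))
  filter_upwards [eventually_ge_atTop 0] with ν hν using abs_besselNormalized_sub_one_le y hν

lemma besselJ_eq_besselNormalized {ν : ℝ} (hν : 0 ≤ ν) (x : ℝ) :
    besselJ ν x = (x / 2) ^ ν * besselNormalized (x ^ 2 / 4) ν / Real.Gamma (ν + 1) := by
  have := (Real.Gamma_pos_of_pos (by linarith : 0 < ν + 1)).ne'
  rw [besselJ_eq, besselNormalized]
  field_simp

lemma hasDerivAt_log_Gamma {s : ℝ} (hs : 0 < s) :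
    HasDerivAt (fun t => Real.log (Real.Gamma t)) (digamma s) s := by
  have h : DifferentiableAt ℝ Real.Gamma s := Real.differentiableAt_Gamma fun m h => by
    have hm : (0 : ℝ) ≤ m := m.cast_nonneg
    linarith
  exact (h.log (Real.Gamma_pos_of_pos hs).ne').hasDerivAt

lemma digamma_add_one {s : ℝ} (hs : 0 < s) : digamma (s + 1) = digamma s + 1 / s := by
  have h1 := (hasDerivAt_log_Gamma (by linarith : 0 < s + 1)).comp_add_const s 1
  have h2 := (hasDerivAt_log_Gamma hs).add (Real.hasDerivAt_log hs.ne')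
  rw [one_div]
  refine h1.unique (h2.congr_of_eventuallyEq ?_)
  filter_upwards [lt_mem_nhds hs] with t ht
  rw [Real.Gamma_add_one ht.ne', Real.log_mul ht.ne' (Real.Gamma_pos_of_pos ht).ne', add_comm]
  rfl

/-- The logarithmic derivative of `besselJ` in the order. -/
lemma tendsto_besselJOrderDeriv_div {x : ℝ} (hx : 0 < x) :
    Tendsto (fun μ => besselJOrderDeriv μ x / besselJ μ x + digamma (μ + 1)) atTop
      (𝓝 (Real.log (x / 2))) := by
  set y := x ^ 2 / 4
  have h2 : 0 < x / 2 := by positivity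
  have hh := (tendsto_besselNormalized y).eventually_const_lt (by norm_num : (1 / 2 : ℝ) < 1)
  have key : ∀ᶠ μ in atTop, |besselJOrderDeriv μ x / besselJ μ x + digamma (μ + 1) -
      Real.log (x / 2)| ≤ 2 * Real.exp |y| / μ := by
    filter_upwards [hh, eventually_ge_atTop 1] with μ hμ h1
    obtain ⟨d, hd, hb⟩ := exists_hasDerivAt_besselNormalized y h1
    have hG := Real.Gamma_pos_of_pos (by linarith : 0 < μ + 1)
    have hJ : HasDerivAt (fun μ => besselJ μ x) (besselJ μ x *
        (Real.log (x / 2) + d / besselNormalized y μ - digamma (μ + 1))) μ := by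
      have e1 := (((hasDerivAt_id μ).const_mul (Real.log (x / 2))).sub
        ((hasDerivAt_log_Gamma (by linarith : 0 < μ + 1)).comp_add_const μ 1)).exp.mul hd
      have e2 : ∀ μ : ℝ, 0 < μ → besselJ μ x =
          Real.exp (Real.log (x / 2) * μ - Real.log (Real.Gamma (μ + 1))) *
            besselNormalized y μ := by
        intro μ hμ
        rw [besselJ_eq_besselNormalized hμ.le, Real.exp_sub, ← Real.rpow_def_of_pos h2,
          Real.exp_log (Real.Gamma_pos_of_pos (by linarith))]
        ring
      refine (e1.congr_of_eventuallyEq ?_).congr_deriv ?_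
      · filter_upwards [lt_mem_nhds (by linarith : 0 < μ)] with t ht using e2 t ht
      · rw [e2 μ (by linarith)]
        simp only [Pi.sub_apply, id]
        field_simp
        ring
    have hJ0 : besselJ μ x ≠ 0 := by
      rw [besselJ_eq_besselNormalized (by linarith)]
      have : 0 < (x / 2) ^ μ := by positivity
      have : 0 < besselNormalized y μ := by linarith
      positivity
    have hJ' := (hasDerivAt_besselJ_order μ hx).unique hJ
    rw [hJ', mul_div_cancel_left₀ _ hJ0,
      show Real.log (x / 2) + d / besselNormalized y μ - digamma (μ + 1) + digamma (μ + 1) -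
        Real.log (x / 2) = d / besselNormalized y μ by ring, abs_div,
      abs_of_pos (by linarith : 0 < besselNormalized y μ)]
    calc |d| / besselNormalized y μ ≤ |d| / (1 / 2) := by gcongr
      _ = 2 * |d| := by ring
      _ ≤ 2 * (Real.exp |y| / μ) := by gcongr
      _ = _ := by ring
  rw [tendsto_iff_norm_sub_tendsto_zero]
  exact squeeze_zero' (Eventually.of_forall fun _ => norm_nonneg _) key
    (tendsto_const_nhds.div_atTop tendsto_id)

lemma exists_besselJ_ratio_bound {x : ℝ} (hx : 0 < x) :
    ∃ K M : ℝ, 0 < K ∧ 1 ≤ M ∧ ∀ μ, M ≤ μ → besselJ μ x ≠ 0 ∧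
      |besselJ (μ + 1) x / besselJ μ x| ≤ K / (μ + 1) ∧
      |2 / (π * x) * (besselJ (μ + 1) x / besselJ μ x) - 1 / (π * (μ + 1))| ≤
        K / (μ + 1) ^ 2 := by
  set y := x ^ 2 / 4
  set C := Real.exp |y| with hC
  have hC0 : 0 < C := Real.exp_pos _
  have h2 : 0 < x / 2 := by positivity
  refine ⟨max (2 * x) (4 * C), max 1 (4 * C), by positivity, le_max_left _ _, fun μ hμ => ?_⟩
  have hμ1 : 1 ≤ μ := (le_max_left _ _).trans hμ
  have hμC : 4 * C ≤ μ := (le_max_right _ _).trans hμ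
  have a0 := abs_besselNormalized_sub_one_le y (by linarith : 0 ≤ μ)
  have a1 := abs_besselNormalized_sub_one_le y (by linarith : 0 ≤ μ + 1)
  have a1' : |besselNormalized y (μ + 1) - 1| ≤ C / (μ + 1) :=
    a1.trans (by gcongr; linarith)
  have hq : C / (μ + 1) ≤ 1 / 4 := by
    rw [div_le_iff₀ (by linarith)]; linarith
  have hpow : 0 < (x / 2) ^ μ := by positivity
  have hG := Real.Gamma_pos_of_pos (by linarith : 0 < μ + 1)
  have e0 := besselJ_eq_besselNormalized (by linarith : 0 ≤ μ) x
  have e1 := besselJ_eq_besselNormalized (by linarith : 0 ≤ μ + 1) x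
  rw [Real.Gamma_add_one (by linarith : μ + 1 ≠ 0), Real.rpow_add_one h2.ne'] at e1
  change besselJ μ x = _ * besselNormalized y μ / _ at e0
  change besselJ (μ + 1) x = _ * besselNormalized y (μ + 1) / _ at e1
  set h := besselNormalized y μ
  set h' := besselNormalized y (μ + 1)
  have b0 := abs_le.1 (a0.trans hq)
  have b1 := abs_le.1 (a1'.trans hq)
  have hpos : 1 / 2 ≤ h := by linarith
  have hpos' : 0 < h := by linarith
  have hρ : besselJ (μ + 1) x / besselJ μ x = x / (2 * (μ + 1)) * (h' / h) := by
    rw [e0, e1]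
    field_simp
  have hdiff : |h' / h - 1| ≤ 4 * C / (μ + 1) := by
    rw [show h' / h - 1 = (h' - h) / h by field_simp, abs_div, abs_of_pos hpos']
    have : |h' - h| ≤ 2 * (C / (μ + 1)) := by
      rw [show h' - h = (h' - 1) - (h - 1) by ring]
      refine (abs_sub _ _).trans ?_
      linarith
    calc |h' - h| / h ≤ 2 * (C / (μ + 1)) / (1 / 2) := by gcongr
      _ = _ := by ring
  refine ⟨by rw [e0]; positivity, ?_, ?_⟩
  · have hle : |h' / h| ≤ 4 := by
      have : 4 * C / (μ + 1) ≤ 1 := by rw [div_le_iff₀ (by linarith)]; linarith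
      have := abs_le.1 (hdiff.trans this)
      rw [abs_le]; constructor <;> linarith
    rw [hρ, abs_mul, abs_of_pos (by positivity)]
    calc x / (2 * (μ + 1)) * |h' / h| ≤ x / (2 * (μ + 1)) * 4 := by gcongr
      _ = 2 * x / (μ + 1) := by field_simp; ring
      _ ≤ _ := by gcongr; exact le_max_left _ _
  · have e : 2 / (π * x) * (x / (2 * (μ + 1)) * (h' / h)) - 1 / (π * (μ + 1)) =
        1 / (π * (μ + 1)) * (h' / h - 1) := by
      field_simp
    rw [hρ, e, abs_mul, abs_of_pos (by have := Real.pi_pos; positivity)]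
    have hπ : 1 / (π * (μ + 1)) ≤ 1 / (μ + 1) := by
      apply one_div_le_one_div_of_le (by linarith)
      exact le_mul_of_one_le_left (by linarith) (by linarith [Real.pi_gt_three])
    calc 1 / (π * (μ + 1)) * |h' / h - 1| ≤ 1 / (μ + 1) * (4 * C / (μ + 1)) := by gcongr
      _ = 4 * C / (μ + 1) ^ 2 := by field_simp
      _ ≤ _ := by gcongr; exact le_max_right _ _

lemma besselJ_mul_besselY_add_one {μ x : ℝ} (hx : 0 < x) (h : besselJ μ x ≠ 0) :
    besselJ (μ + 1) x * besselY (μ + 1) x =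
      (besselJ (μ + 1) x / besselJ μ x) ^ 2 * (besselJ μ x * besselY μ x) -
        2 / (π * x) * (besselJ (μ + 1) x / besselJ μ x) := by
  have hw := besselJ_besselY_wronskian μ hx
  have hπ := Real.pi_ne_zero
  field_simp at hw ⊢
  linear_combination (-besselJ (μ + 1) x) * hw

lemma exists_abs_le_of_abs_succ_le {a : ℕ → ℝ} {c : ℝ} {N : ℕ}
    (h : ∀ n, N ≤ n → |a (n + 1)| ≤ |a n| / 2 + c) : ∃ B, ∀ n, N ≤ n → |a n| ≤ B := by
  refine ⟨max |a N| (2 * c), fun n hn => ?_⟩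
  induction n, hn using Nat.le_induction with
  | base => exact le_max_left _ _
  | succ n hn ih =>
    refine (h n hn).trans ?_
    have := le_max_right |a N| (2 * c)
    linarith

lemma exists_abs_besselJ_mul_besselY_add_le {ν x : ℝ} (hν : 0 < ν) (hx : 0 < x) :
    ∃ (D : ℝ) (N : ℕ), ∀ n : ℕ, N ≤ n →
      |besselJ (ν + n) x * besselY (ν + n) x + 1 / (π * (ν + n))| ≤ D / (ν + n) ^ 2 := by
  obtain ⟨K, M, hK, hM, H⟩ := exists_besselJ_ratio_bound hx
  set P : ℕ → ℝ := fun n => besselJ (ν + n) x * besselY (ν + n) x with hP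
  obtain ⟨N, hN⟩ := exists_nat_ge (max M (2 * K))
  have hstep : ∀ n : ℕ, N ≤ n → |P (n + 1) + 1 / (π * (ν + n + 1))| ≤
      (K ^ 2 * |P n| + K) / (ν + n + 1) ^ 2 := by
    intro n hn
    have hn' : (N : ℝ) ≤ n := by exact_mod_cast hn
    have hMn : M ≤ ν + n := by linarith [le_max_left M (2 * K)]
    obtain ⟨h0, h1, h2⟩ := H _ hMn
    have e : P (n + 1) + 1 / (π * (ν + n + 1)) =
        (besselJ (ν + n + 1) x / besselJ (ν + n) x) ^ 2 * P n -
        (2 / (π * x) * (besselJ (ν + n + 1) x / besselJ (ν + n) x) - 1 / (π * (ν + n + 1))) := by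
      simp only [hP]
      rw [show ν + ((n + 1 : ℕ) : ℝ) = ν + n + 1 by push_cast; ring,
        besselJ_mul_besselY_add_one hx h0]
      ring
    rw [e]
    refine (abs_sub _ _).trans ?_
    rw [abs_mul, abs_pow]
    calc _ ≤ (K / (ν + n + 1)) ^ 2 * |P n| + K / (ν + n + 1) ^ 2 := by gcongr
      _ = _ := by rw [div_pow, div_mul_eq_mul_div, add_div]
  have hB : ∃ B, ∀ n, N ≤ n → |P n| ≤ B := by
    refine exists_abs_le_of_abs_succ_le (c := K + 1) fun n hn => ?_
    have hn' : (N : ℝ) ≤ n := by exact_mod_cast hn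
    have hs : 1 ≤ ν + n + 1 := by linarith [(n.cast_nonneg : (0 : ℝ) ≤ n)]
    have hKs : 2 * K ≤ ν + n + 1 := by linarith [le_max_right M (2 * K)]
    have h1 : |P (n + 1)| ≤ |P (n + 1) + 1 / (π * (ν + n + 1))| + 1 / (π * (ν + n + 1)) := by
      have := abs_sub (P (n + 1) + 1 / (π * (ν + n + 1))) (1 / (π * (ν + n + 1)))
      rwa [add_sub_cancel_right,
        abs_of_pos (by have := Real.pi_pos; positivity : 0 < 1 / (π * (ν + n + 1)))] at this
    have h2 : 1 / (π * (ν + n + 1)) ≤ 1 := by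
      rw [div_le_one (by have := Real.pi_pos; positivity)]
      nlinarith [Real.pi_gt_three]
    have h3 : (K ^ 2 * |P n| + K) / (ν + n + 1) ^ 2 ≤ |P n| / 2 + K := by
      rw [div_le_iff₀ (by positivity)]
      have h4 : K ^ 2 ≤ (ν + n + 1) ^ 2 / 2 := by nlinarith
      have h5 : 1 ≤ (ν + n + 1) ^ 2 := one_le_pow₀ hs
      nlinarith [mul_le_mul_of_nonneg_right h4 (abs_nonneg (P n)),
        mul_le_mul_of_nonneg_left h5 hK.le]
    linarith [hstep n hn]
  obtain ⟨B, hB⟩ := hB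
  refine ⟨K ^ 2 * B + K, N + 1, fun n hn => ?_⟩
  obtain ⟨m, rfl⟩ : ∃ m, n = m + 1 := ⟨n - 1, by omega⟩
  have hm : N ≤ m := by omega
  have h1 := hstep m hm
  have h2 := hB m hm
  rw [show ν + ((m + 1 : ℕ) : ℝ) = ν + m + 1 by push_cast; ring]
  simp only [hP] at h1
  rw [show ν + ((m + 1 : ℕ) : ℝ) = ν + m + 1 by push_cast; ring] at h1
  refine h1.trans ?_
  gcongr

lemma tendsto_besselJ_mul_besselY {ν x : ℝ} (hν : 0 < ν) (hx : 0 < x) :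
    Tendsto (fun n : ℕ => besselJ (ν + n) x * besselY (ν + n) x) atTop (𝓝 0) := by
  obtain ⟨D, N, hD⟩ := exists_abs_besselJ_mul_besselY_add_le hν hx
  have hn : Tendsto (fun n : ℕ => ν + (n : ℝ)) atTop atTop :=
    tendsto_atTop_add_const_left _ _ tendsto_natCast_atTop_atTop
  have h1 : Tendsto (fun n : ℕ => D / (ν + n) ^ 2) atTop (𝓝 0) :=
    tendsto_const_nhds.div_atTop ((tendsto_pow_atTop two_ne_zero).comp hn)
  have h2 : Tendsto (fun n : ℕ => 1 / (π * (ν + n))) atTop (𝓝 0) :=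
    tendsto_const_nhds.div_atTop (hn.const_mul_atTop Real.pi_pos)
  have h3 := (squeeze_zero_norm' (by
    filter_upwards [eventually_ge_atTop N] with n hn using hD n hn) h1).sub h2
  rw [sub_zero] at h3
  exact h3.congr fun n => by ring

lemma tendsto_two_mul_integral_add_digamma {ν x : ℝ} (hν : 0 < ν) (hx : 0 < x) :
    Tendsto (fun n : ℕ => 2 * (ν + n) * (∫ t in Ioi x, besselJ (ν + n) t * besselY (ν + n) t / t) +
      2 / π * digamma (ν + n)) atTop (𝓝 (2 / π * Real.log (x / 2))) := by
  obtain ⟨K, M, hK, hM, H⟩ := exists_besselJ_ratio_bound hx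
  have hn : Tendsto (fun n : ℕ => ν + (n : ℝ)) atTop atTop :=
    tendsto_atTop_add_const_left _ _ tendsto_natCast_atTop_atTop
  have hP := tendsto_besselJ_mul_besselY hν hx
  have hL := (tendsto_besselJOrderDeriv_div hx).comp hn
  have hL1 := ((tendsto_besselJOrderDeriv_div hx).comp (tendsto_atTop_add_const_right _ 1
    tendsto_id)).comp hn
  have hinv : Tendsto (fun n : ℕ => 1 / (ν + (n : ℝ))) atTop (𝓝 0) :=
    tendsto_const_nhds.div_atTop hn
  have hinv1 : Tendsto (fun n : ℕ => 1 / (ν + (n : ℝ) + 1)) atTop (𝓝 0) :=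
    tendsto_const_nhds.div_atTop (tendsto_atTop_add_const_right _ 1 hn)
  have hρ : Tendsto (fun n : ℕ => besselJ (ν + n + 1) x / besselJ (ν + n) x) atTop (𝓝 0) := by
    refine squeeze_zero_norm' ?_ (tendsto_const_nhds.div_atTop
      (tendsto_atTop_add_const_right _ 1 hn) : Tendsto (fun n : ℕ => K / (ν + (n : ℝ) + 1))
      atTop (𝓝 0))
    filter_upwards [hn.eventually_ge_atTop M] with n hn using (H _ hn).2.1
  have key := ((hP.neg).add ((hL.sub hinv).const_mul (2 / π))).add
    (((hL1.sub hL).sub hinv1).mul ((hρ.mul hP).const_mul x))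
  simp only [neg_zero, zero_add, sub_zero, mul_zero, add_zero] at key
  refine key.congr' ?_
  filter_upwards [hn.eventually_ge_atTop M] with n hn
  obtain ⟨h0, -, -⟩ := H _ hn
  have h1 := (H (ν + n + 1) (by linarith)).1
  have hpos : 0 < ν + n := by linarith
  rw [two_mul_integral_besselJ_mul_besselY _ hx]
  simp only [Function.comp, id]
  rw [digamma_add_one (by linarith : 0 < ν + n + 1), digamma_add_one hpos,
    ← besselJ_besselY_wronskian (ν + n) hx]
  field_simp
  ring

lemma sum_besselJ_mul_besselY {ν x : ℝ} (hν : 0 < ν) (hx : 0 < x) (N : ℕ) :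
    ∑ n ∈ Finset.range (N + 1), ((if n = 0 then (1 : ℝ) else 2) * besselJ (ν + n) x *
        besselY (ν + n) x + 2 / (π * (ν + n))) =
      2 * (ν + (N + 1 : ℕ)) * (∫ t in Ioi x, besselJ (ν + (N + 1 : ℕ)) t *
        besselY (ν + (N + 1 : ℕ)) t / t) + 2 / π * digamma (ν + (N + 1 : ℕ)) -
      besselJ (ν + (N + 1 : ℕ)) x * besselY (ν + (N + 1 : ℕ)) x -
      (2 * ν * (∫ t in Ioi x, besselJ ν t * besselY ν t / t) + 2 / π * digamma ν) := by
  have hπ := Real.pi_ne_zero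
  induction N with
  | zero =>
    have h1 := besselJ_besselY_integral_succ ν hx
    have h2 := digamma_add_one hν
    simp only [zero_add, Finset.sum_range_one, if_true, Nat.cast_zero, add_zero, Nat.cast_one]
    rw [h2]
    have h3 : 2 / (π * ν) = 2 / π * (1 / ν) := by field_simp
    linear_combination h3 - h1
  | succ N ih =>
    rw [Finset.sum_range_succ, ih, if_neg (Nat.succ_ne_zero N)]
    have hpos : 0 < ν + ((N + 1 : ℕ) : ℝ) := by positivity
    have h1 := besselJ_besselY_integral_succ (ν + ((N + 1 : ℕ) : ℝ)) hx
    have h2 := digamma_add_one hpos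
    rw [show ν + ((N + 1 + 1 : ℕ) : ℝ) = ν + ((N + 1 : ℕ) : ℝ) + 1 by push_cast; ring, h2]
    have h3 : 2 / (π * (ν + ((N + 1 : ℕ) : ℝ))) = 2 / π * (1 / (ν + ((N + 1 : ℕ) : ℝ))) := by
      field_simp
    linear_combination h3 - h1

lemma summable_besselJ_mul_besselY_add {ν x : ℝ} (hν : 0 < ν) (hx : 0 < x) :
    Summable fun n : ℕ => (if n = 0 then (1 : ℝ) else 2) * besselJ (ν + n) x *
        besselY (ν + n) x + 2 / (π * (ν + n)) := by
  obtain ⟨D, N, hD⟩ := exists_abs_besselJ_mul_besselY_add_le hν hx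
  refine Summable.of_norm_bounded_eventually_nat
    ((Real.summable_one_div_nat_pow.2 one_lt_two).mul_left (2 * D)) ?_
  filter_upwards [eventually_ge_atTop N, eventually_ge_atTop 1] with n hn h1
  have h1' : (1 : ℝ) ≤ n := by exact_mod_cast h1
  have hpos : 0 < ν + (n : ℝ) := by linarith
  have hb := hD n hn
  have hD0 : 0 ≤ D := by
    have := (abs_nonneg _).trans hb
    rwa [le_div_iff₀ (by positivity), zero_mul] at this
  rw [if_neg (by omega), show 2 * besselJ (ν + n) x * besselY (ν + n) x + 2 / (π * (ν + n)) =
    2 * (besselJ (ν + n) x * besselY (ν + n) x + 1 / (π * (ν + n))) by ring, norm_mul,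
    Real.norm_two, mul_assoc, ← div_eq_mul_one_div]
  have : D / (ν + n) ^ 2 ≤ D / (n : ℝ) ^ 2 := by
    gcongr; linarith
  exact mul_le_mul_of_nonneg_left (hb.trans this) (by norm_num)

theorem stmt9 (ν x : ℝ) (hν : 0 < ν) (hx : 0 < x) :
    HasSum (fun n : ℕ =>
        (if n = 0 then (1:ℝ) else 2) * besselJ (ν + n) x * besselY (ν + n) x
          + 2 / (Real.pi * (ν + n)))
      (2 * ν * ((Real.log (x / 2) - digamma ν) / (ν * Real.pi)
        - ∫ t in Set.Ioi x, besselJ ν t * besselY ν t / t)) := by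
  rw [(summable_besselJ_mul_besselY_add hν hx).hasSum_iff_tendsto_nat,
    ← tendsto_add_atTop_iff_nat 1]
  have h := (((tendsto_two_mul_integral_add_digamma hν hx).sub
    (tendsto_besselJ_mul_besselY hν hx)).sub_const
    (2 * ν * (∫ t in Ioi x, besselJ ν t * besselY ν t / t) + 2 / π * digamma ν)).comp
    (tendsto_add_atTop_nat 1)
  have e : 2 * ν * ((Real.log (x / 2) - digamma ν) / (ν * π) -
      ∫ t in Ioi x, besselJ ν t * besselY ν t / t) =
      2 / π * Real.log (x / 2) - 0 -
        (2 * ν * (∫ t in Ioi x, besselJ ν t * besselY ν t / t) + 2 / π * digamma ν) := by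
    have hπ := Real.pi_ne_zero
    field_simp
    ring
  rw [e]
  exact h.congr fun N => (sum_besselJ_mul_besselY hν hx N).symm
end

section
/- Define ζ = ζ(x) for 0 < x ≤ 1 by (2/3) ζ^{3/2} = ln((1 + √(1−x²))/x) − √(1−x²). Then ζ(x) is nonnegative, strictly decreasing on (0,1], ζ(1) = 0, ζ(x) → ∞ as x → 0⁺, and the function x ↦ ζ(x)/(1−x²) extends to an analytic function of ζ near ζ = 0 whose first three Maclaurin coefficients in powers of ζ are a₀ = 2^{−2/3}, a₁ = 2/5, a₂ = (3/35)·2^{2/3}. -/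
open Real Filter Set Topology

noncomputable def besselZeta (x : ℝ) : ℝ :=
  ((3 / 2) * (Real.log ((1 + Real.sqrt (1 - x ^ 2)) / x) - Real.sqrt (1 - x ^ 2))) ^ ((2:ℝ)/3)

theorem HasFPowerSeriesAt.iteratedDeriv_eq_of_ofScalars {f : ℝ → ℝ} {c : ℕ → ℝ} {a : ℝ}
    (hf : HasFPowerSeriesAt f (FormalMultilinearSeries.ofScalars ℝ c) a) (n : ℕ) :
    iteratedDeriv n f a = n.factorial * c n := by
  have h := hf.eq_formalMultilinearSeries hf.analyticAt.hasFPowerSeriesAt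
  have h2 := congrArg (fun p => FormalMultilinearSeries.coeff p n) h
  simp only [FormalMultilinearSeries.coeff_ofScalars] at h2
  have : (n.factorial : ℝ) ≠ 0 := by positivity
  rw [h2]
  field_simp

/-- The function `s ↦ (artanh √s - √s) / √s ^ 3`, as a power series. -/
noncomputable def artanhTail (s : ℝ) : ℝ := ∑' k : ℕ, s ^ k * (1 / (2 * k + 3))

theorem hasSum_artanhTail {s : ℝ} (hs : |s| < 1) :
    HasSum (fun k : ℕ => s ^ k * (1 / (2 * k + 3))) (artanhTail s) := by
  refine Summable.hasSum ?_
  refine Summable.of_norm_bounded (summable_geometric_of_lt_one (abs_nonneg s) hs) fun k => ?_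
  rw [norm_mul, norm_pow, Real.norm_eq_abs, Real.norm_eq_abs]
  refine mul_le_of_le_one_right (by positivity) ?_
  rw [abs_of_nonneg (by positivity), div_le_one (by positivity)]
  have : (0 : ℝ) ≤ k := k.cast_nonneg
  linarith

theorem hasFPowerSeriesAt_artanhTail :
    HasFPowerSeriesAt artanhTail
      (FormalMultilinearSeries.ofScalars ℝ fun k : ℕ => (1 / (2 * k + 3) : ℝ)) 0 := by
  rw [hasFPowerSeriesAt_iff]
  have : ∀ᶠ z : ℝ in 𝓝 0, |z| < 1 :=
    continuous_abs.continuousAt.eventually_lt continuousAt_const (by simp)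
  filter_upwards [this] with z hz
  simpa [FormalMultilinearSeries.coeff_ofScalars] using hasSum_artanhTail hz

theorem artanhTail_zero : artanhTail 0 = 1 / 3 := by
  simpa using hasFPowerSeriesAt_artanhTail.iteratedDeriv_eq_of_ofScalars 0

theorem deriv_artanhTail_zero : deriv artanhTail 0 = 1 / 5 := by
  have := hasFPowerSeriesAt_artanhTail.iteratedDeriv_eq_of_ofScalars 1
  rw [iteratedDeriv_one] at this
  rw [this]
  norm_num

theorem deriv_deriv_artanhTail_zero : deriv (deriv artanhTail) 0 = 2 / 7 := by
  have := hasFPowerSeriesAt_artanhTail.iteratedDeriv_eq_of_ofScalars 2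
  rw [iteratedDeriv_succ, iteratedDeriv_one] at this
  rw [this]
  norm_num [Nat.factorial]

theorem pow_three_mul_artanhTail {t : ℝ} (ht0 : 0 ≤ t) (ht1 : t < 1) :
    t ^ 3 * artanhTail (t ^ 2) = (Real.log (1 + t) - Real.log (1 - t)) / 2 - t := by
  have h1 := hasSum_log_sub_log_of_abs_lt_one (x := t) (by rwa [abs_of_nonneg ht0])
  have h2 := (hasSum_nat_add_iff' 1).mpr h1
  have hs : |t ^ 2| < 1 := by
    rw [abs_of_nonneg (by positivity)]
    nlinarith
  have h3 := (hasSum_artanhTail hs).mul_left (2 * t ^ 3)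
  have hterm : (fun k : ℕ => 2 * (1 / (2 * ((k + 1 : ℕ) : ℝ) + 1)) * t ^ (2 * (k + 1) + 1)) =
      fun k : ℕ => 2 * t ^ 3 * ((t ^ 2) ^ k * (1 / (2 * k + 3))) := by
    funext k
    push_cast
    ring
  rw [hterm] at h2
  have h4 := h3.unique h2
  simp at h4
  linarith

theorem log_one_add_sqrt_div_sub_sqrt {x : ℝ} (hx0 : 0 < x) (hx1 : x ≤ 1) :
    Real.log ((1 + √(1 - x ^ 2)) / x) - √(1 - x ^ 2) =
      √(1 - x ^ 2) ^ 3 * artanhTail (1 - x ^ 2) := by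
  have hs : 0 ≤ 1 - x ^ 2 := by nlinarith
  have h2 := Real.sq_sqrt hs
  have h0 := Real.sqrt_nonneg (1 - x ^ 2)
  set t := √(1 - x ^ 2)
  have ht1 : t < 1 := by nlinarith [pow_pos hx0 2]
  rw [← h2, pow_three_mul_artanhTail h0 ht1]
  have h3 : Real.log (1 + t) + Real.log (1 - t) = 2 * Real.log x := by
    rw [← Real.log_mul (by linarith) (by linarith)]
    have : (1 + t) * (1 - t) = x ^ 2 := by linear_combination -h2
    rw [this, Real.log_pow]
    norm_num
  rw [Real.log_div (by linarith) hx0.ne']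
  linarith

theorem artanhTail_pos {s : ℝ} (hs0 : 0 ≤ s) (hs1 : s < 1) : 0 < artanhTail s := by
  have h := hasSum_artanhTail (s := s) (by rwa [abs_of_nonneg hs0])
  have := sum_le_hasSum {0} (fun k _ => by positivity) h
  norm_num at this
  linarith

theorem artanhTail_mono {s r : ℝ} (hs0 : 0 ≤ s) (hsr : s ≤ r) (hr : r < 1) :
    artanhTail s ≤ artanhTail r := by
  refine hasSum_le (fun k => ?_) (hasSum_artanhTail (by rw [abs_of_nonneg hs0]; linarith))
    (hasSum_artanhTail (by rw [abs_of_nonneg (hs0.trans hsr)]; exact hr))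
  gcongr

/-- The function `ζ / s` in terms of `s = 1 - x ^ 2`. -/
noncomputable def zetaRatio (s : ℝ) : ℝ := (3 / 2 * artanhTail s) ^ ((2 : ℝ) / 3)

theorem besselZeta_eq {x : ℝ} (hx0 : 0 < x) (hx1 : x ≤ 1) :
    besselZeta x = (1 - x ^ 2) * zetaRatio (1 - x ^ 2) := by
  have hs : 0 ≤ 1 - x ^ 2 := by nlinarith
  have hp := (artanhTail_pos hs (by nlinarith [pow_pos hx0 2])).le
  rw [besselZeta, zetaRatio, log_one_add_sqrt_div_sub_sqrt hx0 hx1, mul_left_comm,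
    Real.mul_rpow (by positivity) (by positivity)]
  congr 1
  rw [← Real.rpow_natCast, ← Real.rpow_mul (by positivity)]
  norm_num
  exact Real.sq_sqrt hs

theorem zetaRatio_pos {s : ℝ} (hs0 : 0 ≤ s) (hs1 : s < 1) : 0 < zetaRatio s :=
  Real.rpow_pos_of_pos (mul_pos (by norm_num) (artanhTail_pos hs0 hs1)) _

theorem strictAntiOn_besselZeta : StrictAntiOn besselZeta (Set.Ioc (0 : ℝ) 1) := by
  intro x hx y hy hxy
  rw [besselZeta_eq hx.1 hx.2, besselZeta_eq hy.1 hy.2]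
  have hy0 : 0 ≤ 1 - y ^ 2 := by nlinarith [hy.1, hy.2]
  have hlt : 1 - y ^ 2 < 1 - x ^ 2 := by nlinarith [hx.1]
  have hx1 : 1 - x ^ 2 < 1 := by nlinarith [pow_pos hx.1 2]
  have hm : zetaRatio (1 - y ^ 2) ≤ zetaRatio (1 - x ^ 2) := by
    have := artanhTail_pos hy0 (hlt.trans hx1)
    exact Real.rpow_le_rpow (by positivity)
      (by linarith [artanhTail_mono hy0 hlt.le hx1]) (by norm_num)
  exact mul_lt_mul hlt hm (zetaRatio_pos hy0 (hlt.trans hx1)) (by linarith)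

theorem tendsto_besselZeta_nhdsGT_zero : Tendsto besselZeta (𝓝[>] (0 : ℝ)) atTop := by
  refine (tendsto_rpow_atTop (by norm_num : (0 : ℝ) < 2 / 3)).comp ?_
  refine Tendsto.const_mul_atTop (by norm_num) ?_
  have h : Tendsto (fun x : ℝ => -Real.log x + -1) (𝓝[>] 0) atTop :=
    tendsto_atTop_add_const_right _ _ (tendsto_neg_atBot_atTop.comp Real.tendsto_log_nhdsGT_zero)
  refine tendsto_atTop_mono' _ ?_ h
  filter_upwards [self_mem_nhdsWithin] with x hx
  have hx : 0 < x := hx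
  have h0 := Real.sqrt_nonneg (1 - x ^ 2)
  have h1 : √(1 - x ^ 2) ≤ 1 := Real.sqrt_le_one.mpr (by nlinarith)
  rw [Real.log_div (by linarith) hx.ne']
  linarith [Real.log_nonneg (by linarith : 1 ≤ 1 + √(1 - x ^ 2))]

theorem eventually_artanhTail_pos : ∀ᶠ s in 𝓝 (0 : ℝ), 0 < artanhTail s :=
  continuousAt_const.eventually_lt hasFPowerSeriesAt_artanhTail.analyticAt.continuousAt
    (by rw [artanhTail_zero]; norm_num)

theorem analyticAt_zetaRatio_zero : AnalyticAt ℝ zetaRatio 0 :=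
  ((analyticAt_const.mul hasFPowerSeriesAt_artanhTail.analyticAt).contDiffAt.rpow_const_of_ne
    (by simp [artanhTail_zero])).analyticAt

theorem zetaRatio_zero : zetaRatio 0 = 2 ^ (-(2 : ℝ) / 3) := by
  rw [zetaRatio, artanhTail_zero, neg_div, Real.rpow_neg (by norm_num),
    ← Real.inv_rpow (by norm_num)]
  norm_num

theorem hasDerivAt_zetaRatio {s : ℝ} (hd : DifferentiableAt ℝ artanhTail s)
    (hs : 0 < artanhTail s) :
    HasDerivAt zetaRatio (2 / 3 * (deriv artanhTail s / artanhTail s) * zetaRatio s) s := by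
  have h := (hd.hasDerivAt.const_mul (3 / 2)).rpow_const (p := (2 : ℝ) / 3)
    (Or.inl (by positivity))
  refine h.congr_deriv ?_
  rw [Real.rpow_sub_one (by positivity), zetaRatio]
  field_simp

/-- There is a local analytic inverse of `s ↦ s * zetaRatio s` at `0`. -/
theorem exists_analyticAt_inverse_mul_zetaRatio :
    ∃ S : ℝ → ℝ, AnalyticAt ℝ S 0 ∧ S 0 = 0 ∧
      (∀ᶠ s in 𝓝 (0 : ℝ), S (s * zetaRatio s) = s) ∧
      ∀ᶠ z in 𝓝 (0 : ℝ), S z * zetaRatio (S z) = z := by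
  have hZ : AnalyticAt ℝ (fun s => s * zetaRatio s) 0 := analyticAt_id.mul analyticAt_zetaRatio_zero
  have hd : deriv (fun s => s * zetaRatio s) 0 ≠ 0 := by
    have := (hasDerivAt_id (0 : ℝ)).mul analyticAt_zetaRatio_zero.differentiableAt.hasDerivAt
    have := this.deriv
    simp only [id, one_mul, zero_mul, add_zero] at this
    change deriv (fun s => s * zetaRatio s) 0 = _ at this
    rw [this]
    exact (zetaRatio_pos le_rfl one_pos).ne'
  have hl := HasStrictDerivAt.eventually_left_inverse hZ.hasStrictDerivAt hd
  have hr := HasStrictDerivAt.eventually_right_inverse hZ.hasStrictDerivAt hd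
  have ha := hZ.analyticAt_localInverse hd
  simp only [zero_mul] at hr ha
  refine ⟨_, ha, ?_, hl, hr⟩
  simpa using hl.self_of_nhds

theorem deriv_zetaRatio_comp_eventuallyEq {S : ℝ → ℝ} (hS : AnalyticAt ℝ S 0) (hS0 : S 0 = 0)
    (hr : ∀ᶠ z in 𝓝 (0 : ℝ), S z * zetaRatio (S z) = z) :
    deriv (zetaRatio ∘ S) =ᶠ[𝓝 0] fun z =>
      2 * deriv artanhTail (S z) / (3 * artanhTail (S z) + 2 * (S z * deriv artanhTail (S z))) := by
  have hlim : Tendsto S (𝓝 0) (𝓝 0) := by simpa [hS0] using hS.continuousAt.tendsto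
  filter_upwards [hr.eventually_nhds, hS.eventually_analyticAt,
    hlim.eventually eventually_artanhTail_pos,
    hlim.eventually hasFPowerSeriesAt_artanhTail.analyticAt.eventually_analyticAt]
    with z hz hSz hpos hT
  have hSd := hSz.differentiableAt.hasDerivAt
  have hG := (hasDerivAt_zetaRatio hT.differentiableAt hpos).comp z hSd
  have hone := (hSd.mul hG).unique ((hasDerivAt_id z).congr_of_eventuallyEq hz)
  rw [hG.deriv]
  have hGpos : 0 < zetaRatio (S z) := Real.rpow_pos_of_pos (by positivity) _
  simp only [Function.comp_apply] at hone
  have hkey : zetaRatio (S z) * deriv S z *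
      (3 * artanhTail (S z) + 2 * (S z * deriv artanhTail (S z))) = 3 * artanhTail (S z) := by
    field_simp at hone
    linear_combination hone
  have hne : 3 * artanhTail (S z) + 2 * (S z * deriv artanhTail (S z)) ≠ 0 := by
    intro h0
    rw [h0, mul_zero] at hkey
    linarith
  rw [eq_div_iff hne]
  field_simp
  linear_combination deriv artanhTail (S z) * hkey

theorem deriv_inverse_mul_zetaRatio {S : ℝ → ℝ} (hS : AnalyticAt ℝ S 0) (hS0 : S 0 = 0)
    (hr : ∀ᶠ z in 𝓝 (0 : ℝ), S z * zetaRatio (S z) = z) :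
    deriv S 0 = 2 ^ ((2 : ℝ) / 3) := by
  have hSd := hS.differentiableAt.hasDerivAt
  have hG : HasDerivAt zetaRatio (deriv zetaRatio 0) (S 0) := by
    rw [hS0]
    exact analyticAt_zetaRatio_zero.differentiableAt.hasDerivAt
  have hone := (hSd.mul (hG.comp 0 hSd)).unique ((hasDerivAt_id 0).congr_of_eventuallyEq hr)
  simp only [Function.comp_apply, hS0, zero_mul, add_zero, zetaRatio_zero] at hone
  rw [neg_div, Real.rpow_neg (by norm_num)] at hone
  field_simp at hone
  exact hone

theorem deriv_zetaRatio_comp_zero {S : ℝ → ℝ} (hS : AnalyticAt ℝ S 0) (hS0 : S 0 = 0)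
    (hr : ∀ᶠ z in 𝓝 (0 : ℝ), S z * zetaRatio (S z) = z) :
    deriv (zetaRatio ∘ S) 0 = 2 / 5 := by
  rw [(deriv_zetaRatio_comp_eventuallyEq hS hS0 hr).eq_of_nhds, hS0, artanhTail_zero,
    deriv_artanhTail_zero]
  norm_num

theorem deriv_deriv_zetaRatio_comp_zero {S : ℝ → ℝ} (hS : AnalyticAt ℝ S 0) (hS0 : S 0 = 0)
    (hr : ∀ᶠ z in 𝓝 (0 : ℝ), S z * zetaRatio (S z) = z) :
    deriv (deriv (zetaRatio ∘ S)) 0 = 2 * ((3 / 35) * 2 ^ ((2 : ℝ) / 3)) := by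
  rw [(deriv_zetaRatio_comp_eventuallyEq hS hS0 hr).deriv_eq]
  have hSd := hS.differentiableAt.hasDerivAt
  rw [deriv_inverse_mul_zetaRatio hS hS0 hr] at hSd
  have hA := hasFPowerSeriesAt_artanhTail.analyticAt
  have h1 : HasDerivAt artanhTail (1 / 5) (S 0) := by
    rw [hS0, ← deriv_artanhTail_zero]
    exact hA.differentiableAt.hasDerivAt
  have h2 : HasDerivAt (deriv artanhTail) (2 / 7) (S 0) := by
    rw [hS0, ← deriv_deriv_artanhTail_zero]
    exact hA.deriv.differentiableAt.hasDerivAt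
  have h1S := h1.comp 0 hSd
  have h2S := h2.comp 0 hSd
  have h := (h2S.const_mul 2).div ((h1S.const_mul 3).add ((hSd.mul h2S).const_mul 2))
    (by simp [hS0, artanhTail_zero])
  refine h.deriv.trans ?_
  simp [hS0, artanhTail_zero, deriv_artanhTail_zero]
  ring

theorem stmt16 :
    (∀ x ∈ Set.Ioc (0:ℝ) 1, 0 ≤ besselZeta x) ∧
    StrictAntiOn besselZeta (Set.Ioc (0:ℝ) 1) ∧
    besselZeta 1 = 0 ∧
    Tendsto besselZeta (𝓝[>] (0:ℝ)) atTop ∧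
    ∃ f : ℝ → ℝ, AnalyticAt ℝ f 0 ∧
      (∀ x ∈ Set.Ioo (0:ℝ) 1, f (besselZeta x) = besselZeta x / (1 - x ^ 2)) ∧
      f 0 = 2 ^ (-(2:ℝ)/3) ∧
      deriv f 0 = 2 / 5 ∧
      deriv (deriv f) 0 = 2 * ((3 / 35) * 2 ^ ((2:ℝ)/3)) := by
  have hone : besselZeta 1 = 0 := by simp [besselZeta_eq one_pos le_rfl]
  have hpos : ∀ x ∈ Set.Ioc (0:ℝ) 1, 0 ≤ besselZeta x := fun x hx => by
    rw [← hone]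
    exact strictAntiOn_besselZeta.antitoneOn hx ⟨one_pos, le_rfl⟩ hx.2
  refine ⟨hpos, strictAntiOn_besselZeta, hone, tendsto_besselZeta_nhdsGT_zero, ?_⟩
  obtain ⟨S, hS, hS0, hl, hr⟩ := exists_analyticAt_inverse_mul_zetaRatio
  -- Away from `0`, continue `zetaRatio ∘ S` by inverting `besselZeta` on `(0, 1)`.
  let X := Function.invFunOn besselZeta (Set.Ioo (0:ℝ) 1)
  have hX : ∀ x ∈ Set.Ioo (0:ℝ) 1, X (besselZeta x) = x :=
    (strictAntiOn_besselZeta.injOn.mono Set.Ioo_subset_Ioc_self).leftInvOn_invFunOn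
  classical
  let f : ℝ → ℝ := fun z =>
    if z ∈ besselZeta '' Set.Ioo (0:ℝ) 1 then z / (1 - X z ^ 2) else zetaRatio (S z)
  have hfx : ∀ x ∈ Set.Ioo (0:ℝ) 1, f (besselZeta x) = besselZeta x / (1 - x ^ 2) := by
    intro x hx
    simp only [f, if_pos (Set.mem_image_of_mem besselZeta hx), hX x hx]
  have hf : f =ᶠ[𝓝 0] zetaRatio ∘ S := by
    obtain ⟨ε, hε, hεl⟩ := Metric.eventually_nhds_iff.mp hl
    obtain ⟨x₀, hx₀, hx₀ε⟩ : ∃ x₀ ∈ Set.Ioo (0:ℝ) 1, 1 - x₀ ^ 2 < ε := by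
      have h1 : ∀ᶠ x in 𝓝[<] (1:ℝ), 1 - x ^ 2 < ε :=
        ((by fun_prop : Continuous fun x : ℝ => 1 - x ^ 2).continuousAt.eventually_lt
          continuousAt_const (by simpa using hε)).filter_mono nhdsWithin_le_nhds
      exact (h1.and (Ioo_mem_nhdsLT one_pos)).exists.imp fun x hx => ⟨hx.2, hx.1⟩
    have hz₀ : 0 < besselZeta x₀ := by
      rw [← hone]
      exact strictAntiOn_besselZeta ⟨hx₀.1, hx₀.2.le⟩ ⟨one_pos, le_rfl⟩ hx₀.2
    filter_upwards [eventually_lt_nhds hz₀] with z hz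
    by_cases hmem : z ∈ besselZeta '' Set.Ioo (0:ℝ) 1
    · obtain ⟨x, hx, rfl⟩ := hmem
      have hx₀x : x₀ < x :=
        (strictAntiOn_besselZeta.lt_iff_gt ⟨hx.1, hx.2.le⟩ ⟨hx₀.1, hx₀.2.le⟩).mp hz
      have hs : 0 < 1 - x ^ 2 := by nlinarith [hx.1, hx.2]
      rw [hfx x hx, Function.comp_apply, besselZeta_eq hx.1 hx.2.le, hεl, mul_div_cancel_left₀ _ hs.ne']
      rw [Real.dist_eq, sub_zero, abs_of_pos hs]
      nlinarith [hx₀.1]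
    · simp only [f, if_neg hmem, Function.comp_apply]
  have hcomp : AnalyticAt ℝ (zetaRatio ∘ S) 0 :=
    AnalyticAt.comp (by rw [hS0]; exact analyticAt_zetaRatio_zero) hS
  refine ⟨f, hcomp.congr hf.symm, hfx, ?_, ?_, ?_⟩
  · rw [hf.eq_of_nhds, Function.comp_apply, hS0, zetaRatio_zero]
  · rw [hf.deriv_eq, deriv_zetaRatio_comp_zero hS hS0 hr]
  · rw [hf.deriv.deriv_eq, deriv_deriv_zetaRatio_comp_zero hS hS0 hr]
end
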